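/- arXiv:2509.14135 — 6 statements merged into one kernel-verified Lean document; each statement's English description precedes it below -/
import Mathlib

section
/- Let G be a connected (P2∪P4, bull)-free simple graph, let v be a vertex of G, and let C = v1v2v3v4v5v1 be an induced 5-cycle contained in the set M(v) of vertices distinct from v and nonadjacent to v. Then for every vertex x adjacent to v, either the neighborhood of x in C equals {v_i, v_{i+2}} for some i ∈ {1,...,5} (indices modulo 5), or x is adjacent to all five vertices of C. -/
open SimpleGraph

/-- `H` is (isomorphic to) an induced subgraph of `G`. -/
def ContainsInduced {α β : Type*} (H : SimpleGraph α) (G : SimpleGraph β) : Prop :=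
  ∃ f : α ↪ β, ∀ a b : α, G.Adj (f a) (f b) ↔ H.Adj a b

/-- The disjoint union `P2 ∪ P4`. -/
def P2UnionP4 : SimpleGraph (Fin 6) :=
  SimpleGraph.fromEdgeSet {s(0,1), s(2,3), s(3,4), s(4,5)}

/-- The bull: a triangle with two disjoint pendant edges. -/
def BullGraph : SimpleGraph (Fin 5) :=
  SimpleGraph.fromEdgeSet {s(0,1), s(0,2), s(1,2), s(0,3), s(1,4)}

/-- The triangle `C3`. -/
def TriangleGraph : SimpleGraph (Fin 3) := ⊤

/-- The paw: a triangle with a pendant edge. -/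
def PawGraph : SimpleGraph (Fin 4) :=
  SimpleGraph.fromEdgeSet {s(0,1), s(0,2), s(1,2), s(0,3)}

/-- The diamond: `K4` minus an edge. -/
def DiamondGraph : SimpleGraph (Fin 4) :=
  SimpleGraph.fromEdgeSet {s(0,1), s(0,2), s(0,3), s(1,2), s(1,3)}

/-- The 5-cycle. -/
def Cycle5 : SimpleGraph (Fin 5) :=
  SimpleGraph.fromEdgeSet {s(0,1), s(1,2), s(2,3), s(3,4), s(0,4)}

/-- The 7-cycle. -/
def Cycle7 : SimpleGraph (Fin 7) :=
  SimpleGraph.fromEdgeSet {s(0,1), s(1,2), s(2,3), s(3,4), s(4,5), s(5,6), s(0,6)}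

/-- The Grötzsch graph `F1`: vertex `0` is `v`, vertices `1,…,5` are `w1,…,w5`,
vertices `6,…,10` are `v1,…,v5`; `v` is adjacent exactly to the `wᵢ`, the `vᵢ` form a
5-cycle, and `wᵢ` is adjacent exactly to `v`, `vᵢ` and `vᵢ₊₂` (indices mod 5). -/
def GrotzschGraph : SimpleGraph (Fin 11) :=
  SimpleGraph.fromEdgeSet
    {s(0,1), s(0,2), s(0,3), s(0,4), s(0,5),
     s(6,7), s(7,8), s(8,9), s(9,10), s(6,10),
     s(1,6), s(1,8), s(2,7), s(2,9), s(3,8), s(3,10), s(4,9), s(4,6), s(5,10), s(5,7)}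

/-- The Clebsch graph `F2`: vertices are the elements of `(ℤ/2)⁴`, two vertices adjacent
iff their difference is one of `e1, e2, e3, e4, e1+e2+e3+e4`. -/
def ClebschGraph : SimpleGraph (Fin 4 → ZMod 2) :=
  SimpleGraph.fromRel (fun x y =>
    x - y ∈ ({Pi.single 0 1, Pi.single 1 1, Pi.single 2 1, Pi.single 3 1, 1} :
      Set (Fin 4 → ZMod 2)))

/-- A graph is perfect if every induced subgraph has chromatic number equal to clique number. -/
def SimpleGraph.IsPerfect {V : Type*} (G : SimpleGraph V) : Prop :=
  ∀ S : Set V, (G.induce S).chromaticNumber = ((G.induce S).cliqueNum : ℕ∞)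

/-- A graph is perfectly divisible if each nonempty induced subgraph `H` has a partition
`(A, B)` of its vertex set such that `H[A]` is perfect and `ω(H[B]) < ω(H)`. -/
def SimpleGraph.PerfectlyDivisible {V : Type*} (G : SimpleGraph V) : Prop :=
  ∀ S : Set V, S.Nonempty → ∃ A B : Set V, A ∪ B = S ∧ A ∩ B = ∅ ∧
    (G.induce A).IsPerfect ∧ (G.induce B).cliqueNum < (G.induce S).cliqueNum

/-- A subset of the 5-cycle which contains any vertex following two consecutive members, and which
misses no four consecutive vertices, is a pair at distance two or everything. -/
theorem pair_or_all_of_cyclic (A : Fin 5 → Prop)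
    (hstep : ∀ i, A i → A (i + 1) → A (i + 2))
    (hgap : ∀ i, A (i + 1) ∨ A (i + 2) ∨ A (i + 3) ∨ A (i + 4)) :
    (∃ i : Fin 5, ∀ j, A j ↔ (j = i ∨ j = i + 2)) ∨ ∀ j, A j := by
  classical
  have key : ∀ B : Fin 5 → Bool, (∀ i, B i → B (i + 1) → B (i + 2)) →
      (∀ i, B (i + 1) ∨ B (i + 2) ∨ B (i + 3) ∨ B (i + 4)) →
      (∃ i : Fin 5, ∀ j, B j ↔ (j = i ∨ j = i + 2)) ∨ ∀ j, B j := by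
    decide
  simpa only [decide_eq_true_eq] using key (fun i => decide (A i))
    (by simpa only [decide_eq_true_eq] using hstep)
    (by simpa only [decide_eq_true_eq] using hgap)

/-- If no two vertices of `H` have the same neighbours, then any map that preserves and reflects
adjacency is injective, and so gives an induced copy of `H`. -/
theorem containsInduced_of_adj_iff {α β : Type*} {H : SimpleGraph α} {G : SimpleGraph β}
    (hH : ∀ a b, (∀ d, H.Adj a d ↔ H.Adj b d) → a = b) (f : α → β)
    (hf : ∀ a b, G.Adj (f a) (f b) ↔ H.Adj a b) : ContainsInduced H G :=
  ⟨⟨f, fun a b hab => hH a b fun d => by rw [← hf, ← hf, hab]⟩, hf⟩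

/-- An edge `vx` and an induced path `pqrs` with no edges between them form a `P2 ∪ P4`. -/
theorem containsInduced_P2UnionP4 {V : Type*} {G : SimpleGraph V} {v x p q r s : V}
    (hvx : G.Adj v x) (hpq : G.Adj p q) (hqr : G.Adj q r) (hrs : G.Adj r s)
    (hpr : ¬ G.Adj p r) (hps : ¬ G.Adj p s) (hqs : ¬ G.Adj q s)
    (hvp : ¬ G.Adj v p) (hvq : ¬ G.Adj v q) (hvr : ¬ G.Adj v r) (hvs : ¬ G.Adj v s)
    (hxp : ¬ G.Adj x p) (hxq : ¬ G.Adj x q) (hxr : ¬ G.Adj x r) (hxs : ¬ G.Adj x s) :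
    ContainsInduced P2UnionP4 G := by
  refine containsInduced_of_adj_iff ?_ ![v, x, p, q, r, s] ?_
  · simp only [P2UnionP4, fromEdgeSet_adj, Set.mem_insert_iff, Set.mem_singleton_iff]
    decide
  · intro a b
    fin_cases a <;> fin_cases b <;> simp [P2UnionP4, G.adj_comm, *]

/-- A triangle `pqr` with pendant edges `ps` and `qt` forms a bull. -/
theorem containsInduced_bullGraph {V : Type*} {G : SimpleGraph V} {p q r s t : V}
    (hpq : G.Adj p q) (hpr : G.Adj p r) (hqr : G.Adj q r) (hps : G.Adj p s) (hqt : G.Adj q t)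
    (hpt : ¬ G.Adj p t) (hqs : ¬ G.Adj q s) (hrs : ¬ G.Adj r s) (hrt : ¬ G.Adj r t)
    (hst : ¬ G.Adj s t) :
    ContainsInduced BullGraph G := by
  refine containsInduced_of_adj_iff ?_ ![p, q, r, s, t] ?_
  · simp only [BullGraph, fromEdgeSet_adj, Set.mem_insert_iff, Set.mem_singleton_iff]
    decide
  · intro a b
    fin_cases a <;> fin_cases b <;> simp [BullGraph, G.adj_comm, *]

theorem statement_0 {V : Type*} [Fintype V] (G : SimpleGraph V)
    (hconn : G.Connected)
    (hP : ¬ ContainsInduced P2UnionP4 G)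
    (hbull : ¬ ContainsInduced BullGraph G)
    (v : V) (c : Fin 5 → V) (hinj : Function.Injective c)
    (hM : ∀ i, c i ≠ v ∧ ¬ G.Adj v (c i))
    (hC : ∀ i j, G.Adj (c i) (c j) ↔ (j = i + 1 ∨ i = j + 1))
    (x : V) (hx : G.Adj v x) :
    (∃ i : Fin 5, ∀ j, G.Adj x (c j) ↔ (j = i ∨ j = i + 2)) ∨ (∀ j, G.Adj x (c j)) := by
  refine pair_or_all_of_cyclic _ (fun i h₀ h₁ => ?_) fun i => ?_
  · by_contra h₂
    refine hbull (containsInduced_bullGraph (p := x) (q := c (i + 1)) (r := c i) (s := v)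
      (t := c (i + 2)) h₁ h₀ ?_ hx.symm ?_ h₂ (fun h => (hM _).2 h.symm)
      (fun h => (hM _).2 h.symm) ?_ (hM _).2)
    all_goals rw [hC]; clear * -; revert i; decide
  · by_contra! h
    obtain ⟨h₁, h₂, h₃, h₄⟩ := h
    refine hP (containsInduced_P2UnionP4 hx ?_ ?_ ?_ ?_ ?_ ?_ (hM _).2 (hM _).2 (hM _).2 (hM _).2
      h₁ h₂ h₃ h₄)
    all_goals rw [hC]; clear * -; revert i; decide
end

section
/- Let G be a connected (P2∪P4, bull)-free simple graph, and let C = v1v2v3v4v5v6v7v1 be an induced 7-cycle in G. If no vertex of G is adjacent to all seven vertices of C, then V(C) is a dominating set of G, i.e., every vertex of G outside C has a neighbor in C. -/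
open SimpleGraph

/-- For a pattern graph without twins, an adjacency-preserving and -reflecting map is automatically
injective. -/
lemma containsInduced_of_twinFree {α β : Type*} {H : SimpleGraph α} {G : SimpleGraph β}
    (hH : ∀ a b, (∀ x, H.Adj a x ↔ H.Adj b x) → a = b) (f : α → β)
    (hf : ∀ a b, G.Adj (f a) (f b) ↔ H.Adj a b) : ContainsInduced H G := by
  refine ⟨⟨f, fun a b hab => hH a b fun x => ?_⟩, hf⟩
  rw [← hf, ← hf, hab]

lemma P2UnionP4_twinFree (a b : Fin 6) (h : ∀ x, P2UnionP4.Adj a x ↔ P2UnionP4.Adj b x) :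
    a = b := by
  fin_cases a <;> fin_cases b <;> simp [P2UnionP4, Fin.forall_fin_succ] at h ⊢

lemma BullGraph_twinFree (a b : Fin 5) (h : ∀ x, BullGraph.Adj a x ↔ BullGraph.Adj b x) :
    a = b := by
  fin_cases a <;> fin_cases b <;> simp [BullGraph, Fin.forall_fin_succ] at h ⊢

section

variable {V : Type*} {G : SimpleGraph V}

lemma containsInduced_P2UnionP4_s1 {a b p q r s : V} (hab : G.Adj a b) (hpq : G.Adj p q)
    (hqr : G.Adj q r) (hrs : G.Adj r s) (hap : ¬ G.Adj a p) (haq : ¬ G.Adj a q)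
    (har : ¬ G.Adj a r) (has : ¬ G.Adj a s) (hbp : ¬ G.Adj b p) (hbq : ¬ G.Adj b q)
    (hbr : ¬ G.Adj b r) (hbs : ¬ G.Adj b s) (hpr : ¬ G.Adj p r) (hps : ¬ G.Adj p s)
    (hqs : ¬ G.Adj q s) : ContainsInduced P2UnionP4 G := by
  refine containsInduced_of_twinFree P2UnionP4_twinFree ![a, b, p, q, r, s] fun i j => ?_
  fin_cases i <;> fin_cases j <;> simp [P2UnionP4, G.adj_comm, *]

lemma containsInduced_BullGraph {a b d p q : V} (hab : G.Adj a b) (had : G.Adj a d)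
    (hbd : G.Adj b d) (hap : G.Adj a p) (hbq : G.Adj b q) (haq : ¬ G.Adj a q)
    (hbp : ¬ G.Adj b p) (hdp : ¬ G.Adj d p) (hdq : ¬ G.Adj d q) (hpq : ¬ G.Adj p q) :
    ContainsInduced BullGraph G := by
  refine containsInduced_of_twinFree BullGraph_twinFree ![a, b, d, p, q] fun i j => ?_
  fin_cases i <;> fin_cases j <;> simp [BullGraph, G.adj_comm, *]

end

set_option maxRecDepth 10000 in
/-- A nonempty subset of the 7-cycle that is closed under extending consecutive pairs and is hit by
every four consecutive vertices is either everything or leaves an edge of the cycle far from one of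
its boundary edges. -/
lemma fin_seven_cyclic_pattern : ∀ p : Fin 7 → Bool, (∃ i, p i = true) →
    (∀ i, p i = true → p (i + 1) = true → p (i + 2) = true) →
    (∀ i, p i = true ∨ p (i + 1) = true ∨ p (i + 2) = true ∨ p (i + 3) = true) →
    (∀ i, p i = true → p (i + 1) = false → p (i + 3) = true ∨ p (i + 4) = true) →
    (∀ i, p i = true → p (i + 1) = false → p (i + 4) = true ∨ p (i + 5) = true) →
    ∀ i, p i = true := by
  decide

theorem statement_1 {V : Type*} [Fintype V] (G : SimpleGraph V)
    (hconn : G.Connected)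
    (hP : ¬ ContainsInduced P2UnionP4 G)
    (hbull : ¬ ContainsInduced BullGraph G)
    (c : Fin 7 → V) (hinj : Function.Injective c)
    (hC : ∀ i j, G.Adj (c i) (c j) ↔ (j = i + 1 ∨ i = j + 1))
    (hnc : ¬ ∃ x : V, ∀ i, G.Adj x (c i)) :
    ∀ u : V, u ∉ Set.range c → ∃ i, G.Adj u (c i) := by
  intro u hu
  by_contra hu'
  obtain ⟨w⟩ := hconn.preconnected (c 0) u
  obtain ⟨d, -, hx, hy⟩ := w.exists_boundary_dart {v | v ∈ Set.range c ∨ ∃ i, G.Adj v (c i)}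
    (Or.inl ⟨0, rfl⟩) (by rintro (h | h); exacts [hu h, hu' h])
  obtain ⟨⟨x, y⟩, hxy⟩ := d
  simp only [Set.mem_ofPred_eq, not_or, not_exists] at hx hy
  obtain ⟨-, hyc⟩ := hy
  change G.Adj x y at hxy
  have hyc' : ∀ i, ¬ G.Adj (c i) y := fun i h => hyc i h.symm
  have hex : ∃ i, G.Adj x (c i) := by
    rcases hx with ⟨i, rfl⟩ | h
    · exact absurd hxy (hyc' i)
    · exact h
  classical
  refine hnc ⟨x, fun i => ?_⟩
  have key := fin_seven_cyclic_pattern (fun i => decide (G.Adj x (c i)))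
  simp only [decide_eq_true_eq, decide_eq_false_iff_not] at key
  refine key hex ?_ ?_ ?_ ?_ i
  · intro i h0 h1
    by_contra h2
    refine hbull (containsInduced_BullGraph (a := x) (b := c (i + 1)) (d := c i) (p := y)
      (q := c (i + 2)) h1 h0 ?_ hxy ?_ h2 (hyc' _) (hyc' _) ?_ (hyc _)) <;>
    · rw [hC]; clear * -; decide +revert
  · intro i
    by_contra! h
    obtain ⟨h0, h1, h2, h3⟩ := h
    refine hP (containsInduced_P2UnionP4_s1 (a := y) (b := x) (p := c i) (q := c (i + 1))
      (r := c (i + 2)) (s := c (i + 3)) hxy.symm ?_ ?_ ?_ (hyc _) (hyc _) (hyc _) (hyc _)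
      h0 h1 h2 h3 ?_ ?_ ?_) <;>
    · rw [hC]; clear * -; decide +revert
  · intro i h0 h1
    by_contra! h
    obtain ⟨h3, h4⟩ := h
    refine hP (containsInduced_P2UnionP4_s1 (a := c (i + 3)) (b := c (i + 4)) (p := y) (q := x)
      (r := c i) (s := c (i + 1)) ?_ hxy.symm h0 ?_ (hyc' _) (fun h => h3 h.symm) ?_ ?_
      (hyc' _) (fun h => h4 h.symm) ?_ ?_ (hyc _) (hyc _) h1) <;>
    · rw [hC]; clear * -; decide +revert
  · intro i h0 h1
    by_contra! h
    obtain ⟨h4, h5⟩ := h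
    refine hP (containsInduced_P2UnionP4_s1 (a := c (i + 4)) (b := c (i + 5)) (p := y) (q := x)
      (r := c i) (s := c (i + 1)) ?_ hxy.symm h0 ?_ (hyc' _) (fun h => h4 h.symm) ?_ ?_
      (hyc' _) (fun h => h5 h.symm) ?_ ?_ (hyc _) (hyc _) h1) <;>
    · rw [hC]; clear * -; decide +revert
end

section
/- Let G be a (P2∪P4, bull)-free simple graph, let C = v1v2v3v4v5v6v7v1 be an induced 7-cycle in G, and suppose no vertex of G is adjacent to all seven vertices of C. Then every vertex x ∉ V(C) having a neighbor in C satisfies: the set of neighbors of x in C equals either {v_i, v_{i+2}} or {v_i, v_{i+2}, v_{i+4}} for some i ∈ {1,...,7} (indices modulo 7). -/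
open SimpleGraph

theorem containsInduced_bullGraph_s2 {V : Type*} {G : SimpleGraph V} {a b t a' b' : V}
    (hab : G.Adj a b) (hat : G.Adj a t) (hbt : G.Adj b t) (haa' : G.Adj a a')
    (hbb' : G.Adj b b') (nab' : ¬ G.Adj a b') (nba' : ¬ G.Adj b a') (nta' : ¬ G.Adj t a')
    (ntb' : ¬ G.Adj t b') (na'b' : ¬ G.Adj a' b') : ContainsInduced BullGraph G := by
  refine containsInduced_of_adj_iff ?_ ![a, b, t, a', b'] ?_
  · simp only [BullGraph, fromEdgeSet_adj, Set.mem_insert_iff, Set.mem_singleton_iff]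
    decide
  · intro i j
    fin_cases i <;> fin_cases j <;>
      simp [BullGraph, *, hab.symm, hat.symm, hbt.symm, haa'.symm, hbb'.symm,
        mt G.adj_symm nab', mt G.adj_symm nba', mt G.adj_symm nta', mt G.adj_symm ntb',
        mt G.adj_symm na'b']

theorem containsInduced_p2UnionP4 {V : Type*} {G : SimpleGraph V} {a b u v w z : V}
    (hab : G.Adj a b) (huv : G.Adj u v) (hvw : G.Adj v w) (hwz : G.Adj w z)
    (nuw : ¬ G.Adj u w) (nuz : ¬ G.Adj u z) (nvz : ¬ G.Adj v z)
    (nau : ¬ G.Adj a u) (nav : ¬ G.Adj a v) (naw : ¬ G.Adj a w) (naz : ¬ G.Adj a z)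
    (nbu : ¬ G.Adj b u) (nbv : ¬ G.Adj b v) (nbw : ¬ G.Adj b w) (nbz : ¬ G.Adj b z) :
    ContainsInduced P2UnionP4 G := by
  refine containsInduced_of_adj_iff ?_ ![a, b, u, v, w, z] ?_
  · simp only [P2UnionP4, fromEdgeSet_adj, Set.mem_insert_iff, Set.mem_singleton_iff]
    decide
  · intro i j
    fin_cases i <;> fin_cases j <;>
      simp [P2UnionP4, *, hab.symm, huv.symm, hvw.symm, hwz.symm, mt G.adj_symm nuw, mt G.adj_symm nuz,
        mt G.adj_symm nvz, mt G.adj_symm nau, mt G.adj_symm nav, mt G.adj_symm naw, mt G.adj_symm naz,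
        mt G.adj_symm nbu, mt G.adj_symm nbv, mt G.adj_symm nbw, mt G.adj_symm nbz]

set_option maxRecDepth 100000 in
/-- The traces on a 7-cycle that avoid six local patterns. -/
theorem exists_trace_eq_of_avoids (p : Fin 7 → Bool) (hne : ∃ i, p i = true)
    (hnf : ∃ i, p i = false)
    (h : ∀ i, ¬ (p (i + 5) = true ∧ p i = false ∧ p (i + 1) = false ∧ p (i + 3) = false ∧
        p (i + 4) = false) ∧
      ¬ (p i = true ∧ p (i + 2) = false ∧ p (i + 3) = false ∧ p (i + 4) = false ∧
        p (i + 5) = false) ∧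
      ¬ (p i = true ∧ p (i + 1) = true ∧ p (i + 6) = false ∧ p (i + 2) = false) ∧
      ¬ (p i = true ∧ p (i + 1) = true ∧ p (i + 3) = true ∧ p (i + 6) = false) ∧
      ¬ (p i = true ∧ p (i + 1) = true ∧ p (i + 4) = true ∧ p (i + 6) = false) ∧
      ¬ (p i = true ∧ p (i + 6) = true ∧ p (i + 3) = true ∧ p (i + 1) = false)) :
    ∃ i, (∀ j, p j = true ↔ (j = i ∨ j = i + 2)) ∨
      (∀ j, p j = true ↔ (j = i ∨ j = i + 2 ∨ j = i + 4)) := by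
  revert p
  decide

theorem statement_2 {V : Type*} [Fintype V] (G : SimpleGraph V)
    (hP : ¬ ContainsInduced P2UnionP4 G)
    (hbull : ¬ ContainsInduced BullGraph G)
    (c : Fin 7 → V) (hinj : Function.Injective c)
    (hC : ∀ i j, G.Adj (c i) (c j) ↔ (j = i + 1 ∨ i = j + 1))
    (hnc : ¬ ∃ x : V, ∀ i, G.Adj x (c i))
    (x : V) (hx : x ∉ Set.range c) (hxN : ∃ i, G.Adj x (c i)) :
    ∃ i : Fin 7, (∀ j, G.Adj x (c j) ↔ (j = i ∨ j = i + 2)) ∨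
      (∀ j, G.Adj x (c j) ↔ (j = i ∨ j = i + 2 ∨ j = i + 4)) := by
  classical
  have hnf : ∃ i, ¬ G.Adj x (c i) := by
    by_contra! h
    exact hnc ⟨x, h⟩
  have := exists_trace_eq_of_avoids (fun i => decide (G.Adj x (c i))) (by simpa using hxN)
    (by simpa using hnf) fun i => by
      simp only [decide_eq_true_eq, decide_eq_false_iff_not]
      refine ⟨?_, ?_, ?_, ?_, ?_, ?_⟩
      · rintro ⟨h5, n0, n1, n3, n4⟩
        refine hP (containsInduced_p2UnionP4 (a := c i) (b := c (i + 1)) (u := c (i + 3))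
          (v := c (i + 4)) (w := c (i + 5)) (z := x) ?_ ?_ ?_ ?_ ?_ ?_ ?_ ?_ ?_ ?_ ?_ ?_ ?_ ?_ ?_)
          <;> first | assumption | rwa [G.adj_comm] | (rw [hC]; clear * -; decide +revert)
      · rintro ⟨h0, n2, n3, n4, n5⟩
        refine hP (containsInduced_p2UnionP4 (a := c i) (b := x) (u := c (i + 2))
          (v := c (i + 3)) (w := c (i + 4)) (z := c (i + 5))
          ?_ ?_ ?_ ?_ ?_ ?_ ?_ ?_ ?_ ?_ ?_ ?_ ?_ ?_ ?_)
          <;> first | assumption | rwa [G.adj_comm] | (rw [hC]; clear * -; decide +revert)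
      · rintro ⟨h0, h1, n6, n2⟩
        refine hbull (containsInduced_bullGraph_s2 (a := c i) (b := c (i + 1)) (t := x)
          (a' := c (i + 6)) (b' := c (i + 2)) ?_ ?_ ?_ ?_ ?_ ?_ ?_ ?_ ?_ ?_)
          <;> first | assumption | rwa [G.adj_comm] | (rw [hC]; clear * -; decide +revert)
      · rintro ⟨h0, h1, h3, n6⟩
        refine hbull (containsInduced_bullGraph_s2 (a := c i) (b := x) (t := c (i + 1))
          (a' := c (i + 6)) (b' := c (i + 3)) ?_ ?_ ?_ ?_ ?_ ?_ ?_ ?_ ?_ ?_)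
          <;> first | assumption | rwa [G.adj_comm] | (rw [hC]; clear * -; decide +revert)
      · rintro ⟨h0, h1, h4, n6⟩
        refine hbull (containsInduced_bullGraph_s2 (a := c i) (b := x) (t := c (i + 1))
          (a' := c (i + 6)) (b' := c (i + 4)) ?_ ?_ ?_ ?_ ?_ ?_ ?_ ?_ ?_ ?_)
          <;> first | assumption | rwa [G.adj_comm] | (rw [hC]; clear * -; decide +revert)
      · rintro ⟨h0, h6, h3, n1⟩
        refine hbull (containsInduced_bullGraph_s2 (a := c i) (b := x) (t := c (i + 6))
          (a' := c (i + 1)) (b' := c (i + 3)) ?_ ?_ ?_ ?_ ?_ ?_ ?_ ?_ ?_ ?_)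
          <;> first | assumption | rwa [G.adj_comm] | (rw [hC]; clear * -; decide +revert)
  simpa only [decide_eq_true_eq] using this
end

section
/- Let G be a connected (P2∪P4, C3)-free simple graph. Then at least one of the following holds: (i) G has a comparable pair, i.e., two nonadjacent vertices u, v with N(u) ⊆ N(v); (ii) the chromatic number of G is at most 3; (iii) G contains the Grötzsch graph F1 as an induced subgraph and G is isomorphic to an induced subgraph of the Clebsch graph F2. -/
open SimpleGraph

/-- The adjacency relation of the graph on `0, …, rows.length - 1` whose `i`-th adjacency row is
the binary number `rows[i]`. -/
def rowAdj (rows : List ℕ) (i j : ℕ) : Bool := (rows.getD i 0).testBit j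

def triangleRows : List ℕ := [6, 5, 3]

def p2UnionP4Rows : List ℕ := [2, 1, 8, 20, 40, 16]

def grotzschRows : List ℕ := [62, 321, 641, 1281, 577, 1153, 1170, 356, 650, 1300, 616]

/-- The partial adjacency table `val` shows that the vertices listed in `w` induce the graph coded
by `rows`. -/
def hits (val : ℕ → ℕ → Option Bool) (rows w : List ℕ) : Bool :=
  w.length == rows.length && (List.range rows.length).all fun i => (List.range i).all fun j =>
    val (w.getD i 0) (w.getD j 0) == some (rowAdj rows i j)

/-- The vertices listed in `w` induce a triangle or a `P2 ∪ P4`. -/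
def excludes (val : ℕ → ℕ → Option Bool) (w : List ℕ) : Bool :=
  hits val triangleRows w || hits val p2UnionP4Rows w

/-- The adjacency table of a root with rows `rows` and one further vertex, whose adjacencies to the
first `k` root vertices are given by the binary digits of `m`. -/
def prefixTable (rows : List ℕ) (k m a b : ℕ) : Option Bool :=
  if a < rows.length ∧ b < rows.length then some (rowAdj rows a b)
  else if min a b < k then some (m.testBit (min a b)) else none

/-- Every extension of the mask `m` of length `k` by `d` further digits lies in `L` or is excluded
by one of the witnesses `ws`. -/
def typesCheck (rows L : List ℕ) (ws : List (List ℕ)) : ℕ → ℕ → ℕ → Bool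
  | 0, k, m => L.contains m || ws.any (excludes (prefixTable rows k m))
  | d + 1, k, m => ws.any (excludes (prefixTable rows k m)) ||
      (typesCheck rows L ws d (k + 1) m && typesCheck rows L ws d (k + 1) (m ||| 2 ^ k))

/-- The adjacency table in which the adjacencies to the `n` root vertices are read off from
masks. -/
def maskTable (n : ℕ) (msk : ℕ → ℕ) (kn : ℕ → ℕ → Option Bool) (a b : ℕ) : Option Bool :=
  if a < n then some ((msk b).testBit a) else if b < n then some ((msk a).testBit b) else kn a b

/-- The masks of the root vertices and of two further vertices of masks `s` and `t`. -/
def pairMask (rows : List ℕ) (s t a : ℕ) : ℕ :=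
  if a < rows.length then rows.getD a 0 else if a = rows.length then s else t

def pairExcluded (rows : List ℕ) (wp : List (List ℕ)) (s t : ℕ) (x : Bool) : Bool :=
  wp.any <| excludes <| maskTable rows.length (pairMask rows s t) fun a b =>
    if a ≠ b ∧ (a = rows.length ∨ b = rows.length) then some x else none

/-- Every combination of two types and an adjacency status that is not permitted by `T0` and `T1`
is excluded by one of the witnesses `wp`. -/
def pairsCheck (rows L T0 T1 : List ℕ) (wp : List (List ℕ)) : Bool :=
  (List.range L.length).all fun i => (List.range (i + 1)).all fun j => [false, true].all fun x =>
    (rowAdj (if x then T1 else T0) i j && rowAdj (if x then T1 else T0) j i) ||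
      pairExcluded rows wp (L.getD j 0) (L.getD i 0) x

/-- The rows of a 5-cycle and a vertex anticomplete to it. -/
def pentagonRows : List ℕ :=
  [18, 5, 10, 20, 9, 0]

def pentagonTypes : List ℕ :=
  [0, 1, 2, 4, 5, 8, 9, 10, 16, 18, 20, 37, 41, 42, 50, 52]

def pentagonTypeWitnesses : List (List ℕ) :=
  [[0, 1, 6], [0, 4, 6], [1, 2, 6], [2, 3, 6], [3, 4, 6], [5, 6, 0, 4, 3, 2], [5, 6, 1, 0, 4,
    3], [5, 6, 0, 1, 2, 3], [5, 6, 2, 1, 0, 4], [5, 6, 1, 2, 3, 4]]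

/-- The rows of a 7-cycle and a vertex anticomplete to it. -/
def heptagonRows : List ℕ :=
  [66, 5, 10, 20, 40, 80, 33, 0]

def heptagonTypes : List ℕ :=
  [0, 5, 10, 20, 21, 33, 37, 40, 41, 42, 66, 74, 80, 82, 84]

def heptagonTypeWitnesses : List (List ℕ) :=
  [[0, 1, 8], [0, 6, 8], [1, 2, 8], [2, 3, 8], [3, 4, 8], [4, 5, 8], [5, 6, 8], [7, 8, 3, 4, 5,
    6], [0, 1, 5, 4, 3, 8], [1, 2, 6, 5, 4, 8], [0, 1, 3, 4, 5, 8], [3, 4, 1, 0, 6, 8], [4, 5, 2,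
    1, 0, 8], [3, 4, 6, 0, 1, 8], [4, 5, 0, 1, 8, 7], [0, 1, 3, 4, 8, 7], [1, 2, 4, 5, 8, 7], [5,
    6, 3, 2, 1, 8], [0, 6, 4, 3, 2, 8], [3, 4, 6, 0, 8, 7], [5, 6, 3, 2, 8, 7], [0, 6, 4, 3, 8,
    7], [2, 3, 5, 6, 8, 7]]

/-- The rows of a 5-cycle, a vertex anticomplete to it and two common neighbors. -/
def octadRows : List ℕ :=
  [82, 133, 74, 148, 9, 192, 37, 42]

def octadTypes : List ℕ :=
  [0, 2, 4, 9, 37, 41, 42, 50, 52, 72, 74, 82, 129, 133, 148, 192, 208]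

def octadTypeWitnesses : List (List ℕ) :=
  [[0, 1, 8], [0, 4, 8], [0, 6, 8], [1, 2, 8], [1, 7, 8], [2, 3, 8], [2, 6, 8], [3, 4, 8], [3,
    7, 8], [5, 6, 8], [5, 7, 8], [4, 8, 6, 2, 1, 7], [5, 8, 0, 4, 3, 2], [0, 8, 2, 3, 7, 5], [5,
    7, 2, 8, 0, 4], [3, 8, 1, 0, 6, 5], [5, 6, 1, 8, 3, 4], [4, 8, 2, 6, 5, 7], [4, 8, 2, 1, 7,
    5], [4, 8, 1, 7, 5, 6], [4, 8, 1, 2, 6, 5], [5, 8, 2, 1, 0, 4], [5, 8, 1, 0, 4, 3], [5, 8, 1,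
    2, 3, 4], [6, 8, 1, 7, 3, 4], [3, 4, 1, 8, 6, 5], [7, 8, 2, 6, 0, 4], [0, 4, 2, 8, 7, 5]]

def octadMayMiss : List ℕ :=
  [131071, 64735, 61279, 112255, 29183, 112633, 4095, 89587, 93173, 114541, 114415, 118727,
    128699, 128831, 129431, 130607, 130985]

def octadMayMeet : List ℕ :=
  [9216, 74528, 70816, 117120, 101888, 51206, 126976, 41484, 37898, 28818, 28949, 12344, 3908,
    3779, 1640, 504, 94]

def octadPairWitnesses : List (List ℕ) :=
  [[1, 8, 9], [2, 8, 9], [3, 8, 9], [7, 8, 9], [0, 8, 9], [4, 8, 9], [6, 8, 9], [5, 8, 9], [8,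
    9, 3, 2, 6, 5], [8, 9, 0, 1, 7, 5], [5, 7, 4, 0, 9, 8], [3, 4, 5, 6, 9, 8], [3, 7, 6, 0, 9,
    8], [0, 6, 7, 3, 9, 8], [3, 7, 0, 6, 9, 8], [5, 6, 3, 4, 9, 8], [8, 9, 0, 1, 2, 3], [8, 9, 3,
    4, 0, 6], [8, 9, 6, 2, 1, 7], [8, 9, 6, 2, 3, 7], [8, 9, 0, 1, 7, 3], [1, 8, 3, 9, 5, 6], [1,
    8, 4, 9, 5, 6], [1, 8, 3, 9, 6, 5], [1, 8, 4, 9, 6, 5], [2, 8, 4, 0, 9, 5], [2, 8, 0, 4, 9,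
    5], [2, 8, 4, 0, 9, 7], [2, 8, 0, 4, 9, 7], [5, 9, 0, 8, 3, 2], [0, 8, 2, 9, 5, 7], [5, 7, 8,
    0, 4, 9], [5, 6, 8, 3, 4, 9], [3, 9, 1, 0, 8, 5], [5, 8, 1, 9, 3, 4], [5, 8, 1, 9, 4, 3], [3,
    4, 8, 5, 6, 9], [4, 9, 1, 2, 8, 5], [5, 8, 2, 1, 9, 4], [5, 8, 1, 2, 9, 4], [1, 2, 4, 9, 8,
    5], [0, 9, 2, 3, 8, 5], [5, 8, 2, 9, 0, 4], [4, 9, 1, 8, 5, 6], [0, 4, 8, 5, 7, 9], [4, 9, 2,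
    1, 8, 5], [6, 9, 4, 8, 1, 7], [2, 3, 0, 9, 8, 5], [5, 8, 0, 9, 2, 3], [4, 8, 2, 6, 9, 7], [0,
    1, 3, 9, 8, 5], [5, 8, 0, 1, 9, 3], [7, 9, 4, 8, 2, 6], [4, 8, 1, 7, 9, 6], [6, 8, 1, 7, 9,
    4], [4, 9, 1, 8, 6, 5], [7, 9, 2, 6, 8, 4], [4, 8, 2, 9, 7, 5]]

def grotzschTypes : List ℕ :=
  [0, 62, 76, 152, 304, 321, 356, 546, 577, 616, 641, 650, 1030, 1153, 1170, 1281, 1300]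

def grotzschTypeWitnesses : List (List ℕ) :=
  [[0, 1, 11], [0, 2, 11], [0, 3, 11], [0, 4, 11], [0, 5, 11], [1, 6, 11], [1, 8, 11], [2, 7,
    11], [2, 9, 11], [3, 8, 11], [3, 10, 11], [4, 6, 11], [4, 9, 11], [5, 7, 11], [5, 10, 11], [6,
    7, 11], [6, 10, 11], [7, 8, 11], [8, 9, 11], [9, 10, 11], [1, 11, 7, 2, 9, 10], [2, 11, 6, 10,
    3, 8], [5, 11, 1, 8, 9, 4], [3, 11, 1, 6, 7, 5], [4, 11, 3, 8, 7, 5], [1, 11, 2, 9, 10, 5],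
    [2, 11, 1, 6, 10, 3], [3, 11, 2, 7, 6, 4], [5, 11, 6, 1, 8, 9], [6, 11, 5, 0, 3, 8], [7, 11,
    1, 0, 4, 9], [8, 11, 2, 0, 4, 6], [9, 11, 5, 0, 1, 6], [0, 11, 6, 7, 8, 9], [1, 11, 7, 5, 10,
    9], [6, 11, 5, 0, 2, 9], [10, 11, 4, 0, 2, 7], [0, 11, 7, 8, 9, 10], [0, 11, 6, 10, 9, 8], [0,
    11, 8, 7, 6, 10], [0, 11, 7, 6, 10, 9], [1, 11, 3, 10, 5, 7], [2, 11, 3, 8, 1, 6], [3, 11, 7,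
    6, 4, 9], [4, 11, 3, 10, 5, 7], [4, 11, 1, 8, 3, 10], [5, 11, 3, 8, 1, 6], [6, 11, 3, 0, 2,
    9], [6, 11, 2, 0, 3, 8], [7, 11, 4, 0, 3, 10], [7, 11, 3, 0, 4, 9], [8, 11, 5, 0, 4, 6], [8,
    11, 4, 0, 5, 10], [9, 11, 1, 0, 5, 7], [10, 11, 1, 0, 2, 7], [10, 11, 2, 0, 1, 8]]

def grotzschMayMiss : List ℕ :=
  [131071, 88799, 80751, 93759, 116475, 108413, 103415, 57299, 49125, 4095, 61369, 32655,
    129479, 130349, 130203, 128497, 127103]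

def grotzschMayMeet : List ℕ :=
  [0, 42272, 50320, 37312, 14596, 22658, 27656, 73772, 81946, 126976, 69702, 98416, 1592, 722,
    868, 2574, 3968]

def grotzschPairWitnesses : List (List ℕ) :=
  [[2, 11, 12], [7, 11, 12], [5, 11, 12], [0, 11, 12], [4, 11, 12], [6, 11, 12], [1, 11, 12],
    [8, 11, 12], [9, 11, 12], [10, 11, 12], [11, 12, 2, 9, 10, 5], [3, 11, 12], [11, 12, 1, 6, 10,
    3], [11, 12, 3, 8, 7, 5], [11, 12, 1, 8, 9, 4], [11, 12, 2, 7, 6, 4], [11, 12, 1, 0, 5, 7],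
    [11, 12, 0, 2, 9, 8], [11, 12, 4, 0, 1, 8], [11, 12, 5, 0, 4, 6], [11, 12, 3, 10, 9, 4], [11,
    12, 6, 10, 9, 8], [6, 12, 5, 11, 2, 9], [9, 12, 3, 11, 5, 7], [9, 12, 5, 11, 1, 6], [1, 11, 7,
    12, 10, 9], [2, 11, 6, 10, 12, 8], [2, 11, 4, 12, 5, 10], [9, 12, 3, 11, 6, 7], [3, 11, 5, 7,
    12, 9], [3, 11, 7, 12, 4, 9], [2, 11, 5, 10, 12, 8], [4, 11, 1, 8, 12, 2], [9, 12, 0, 3, 11,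
    7], [9, 12, 3, 11, 7, 5], [4, 11, 1, 12, 10, 5], [7, 11, 0, 12, 10, 9], [6, 12, 3, 8, 11, 5],
    [4, 11, 2, 7, 12, 3], [2, 12, 3, 8, 11, 5], [4, 11, 2, 7, 12, 10], [6, 11, 2, 9, 12, 5], [9,
    12, 5, 0, 11, 6], [2, 12, 3, 8, 11, 6], [8, 11, 4, 12, 10, 5], [6, 11, 3, 0, 12, 9], [3, 12,
    2, 11, 6, 4], [0, 12, 6, 11, 8, 9], [8, 11, 0, 4, 12, 10], [1, 11, 2, 7, 12, 10], [1, 11, 2,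
    12, 10, 3], [7, 12, 3, 0, 11, 9], [8, 12, 5, 0, 11, 6], [2, 12, 6, 11, 3, 8], [1, 8, 11, 5,
    10, 12], [1, 12, 2, 9, 11, 3], [0, 12, 7, 6, 11, 9], [2, 12, 1, 6, 11, 5], [10, 12, 0, 11, 7,
    8], [1, 6, 11, 9, 2, 12], [4, 6, 11, 3, 8, 12], [2, 12, 3, 11, 1, 6]]

theorem pentagon_typesCheck :
    typesCheck pentagonRows pentagonTypes pentagonTypeWitnesses pentagonRows.length 0 0 := by
  decide +kernel

theorem heptagon_typesCheck :
    typesCheck heptagonRows heptagonTypes heptagonTypeWitnesses heptagonRows.length 0 0 := by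
  decide +kernel

theorem octad_typesCheck :
    typesCheck octadRows octadTypes octadTypeWitnesses octadRows.length 0 0 := by
  decide +kernel

theorem octad_pairsCheck :
    pairsCheck octadRows octadTypes octadMayMiss octadMayMeet octadPairWitnesses := by
  decide +kernel

theorem grotzsch_typesCheck :
    typesCheck grotzschRows grotzschTypes grotzschTypeWitnesses grotzschRows.length 0 0 := by
  decide +kernel

theorem grotzsch_pairsCheck :
    pairsCheck grotzschRows grotzschTypes grotzschMayMiss grotzschMayMeet
      grotzschPairWitnesses := by
  decide +kernel

section

variable {V : Type*} {G : SimpleGraph V}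

def IsSoundTable (G : SimpleGraph V) (g : ℕ → V) (val : ℕ → ℕ → Option Bool) : Prop :=
  ∀ a b x, val a b = some x → (G.Adj (g a) (g b) ↔ x = true)

def HasRows (G : SimpleGraph V) (g : ℕ → V) (rows : List ℕ) : Prop :=
  ∀ a < rows.length, ∀ b < rows.length, (G.Adj (g a) (g b) ↔ rowAdj rows a b = true)

theorem hits_adj {g : ℕ → V} {val : ℕ → ℕ → Option Bool} (hval : IsSoundTable G g val)
    {rows w : List ℕ} (h : hits val rows w)
    (hrows : ∀ i < rows.length, rowAdj rows i i = false ∧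
      ∀ j < rows.length, rowAdj rows i j = rowAdj rows j i) :
    HasRows G (fun i => g (w.getD i 0)) rows := by
  have key : ∀ i < rows.length, ∀ j < i,
      (G.Adj (g (w.getD i 0)) (g (w.getD j 0)) ↔ rowAdj rows i j = true) := by
    intro i hi j hj
    simp only [hits, Bool.and_eq_true, List.all_eq_true, List.mem_range, beq_iff_eq] at h
    exact hval _ _ _ (h.2 i hi j hj)
  intro i hi j hj
  rcases lt_trichotomy i j with hij | rfl | hij
  · rw [G.adj_comm, key j hj i hij, (hrows i hi).2 j hj]
  · simp [(hrows i hi).1]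
  · exact key i hi j hij

theorem containsInduced_of_rows {n : ℕ} {H : SimpleGraph (Fin n)} {rows : List ℕ}
    (hn : rows.length = n) (hH : ∀ i j : Fin n, H.Adj i j ↔ rowAdj rows i j = true)
    (htwin : ∀ i j : Fin n, i ≠ j → ∃ k : Fin n, rowAdj rows i k ≠ rowAdj rows j k)
    {g : ℕ → V} (hg : HasRows G g rows) : ContainsInduced H G := by
  subst hn
  refine ⟨⟨fun i => g i, fun i j hij => ?_⟩, fun i j => ?_⟩
  · by_contra hne
    obtain ⟨k, hk⟩ := htwin i j hne
    apply hk
    rw [Bool.eq_iff_iff, ← hg i i.2 k k.2, ← hg j j.2 k k.2]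
    simp only at hij
    rw [hij]
  · rw [hH, ← hg i i.2 j j.2]
    rfl

theorem containsInduced_triangleGraph {g : ℕ → V} (hg : HasRows G g triangleRows) :
    ContainsInduced TriangleGraph G :=
  containsInduced_of_rows rfl (by simp only [TriangleGraph, top_adj]; decide) (by decide) hg

theorem containsInduced_p2UnionP4_s3 {g : ℕ → V} (hg : HasRows G g p2UnionP4Rows) :
    ContainsInduced P2UnionP4 G :=
  containsInduced_of_rows rfl
    (by simp only [P2UnionP4, fromEdgeSet_adj, Set.mem_insert_iff, Set.mem_singleton_iff]; decide)
    (by decide) hg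

theorem grotzschGraph_adj_iff (i j : Fin 11) :
    GrotzschGraph.Adj i j ↔ rowAdj grotzschRows i j = true := by
  revert i j
  simp only [GrotzschGraph, fromEdgeSet_adj, Set.mem_insert_iff, Set.mem_singleton_iff]
  decide +kernel

theorem containsInduced_grotzschGraph {g : ℕ → V} (hg : HasRows G g grotzschRows) :
    ContainsInduced GrotzschGraph G :=
  containsInduced_of_rows rfl grotzschGraph_adj_iff (by decide +kernel) hg

theorem not_excludes (hP : ¬ ContainsInduced P2UnionP4 G) (hC3 : ¬ ContainsInduced TriangleGraph G)
    {g : ℕ → V} {val : ℕ → ℕ → Option Bool} (hval : IsSoundTable G g val) (w : List ℕ) :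
    excludes val w = false := by
  rw [excludes, Bool.or_eq_false_iff, ← Bool.not_eq_true, ← Bool.not_eq_true]
  exact ⟨fun h => hC3 (containsInduced_triangleGraph (hits_adj hval h (by decide))),
    fun h => hP (containsInduced_p2UnionP4_s3 (hits_adj hval h (by decide)))⟩

theorem any_excludes (hP : ¬ ContainsInduced P2UnionP4 G)
    (hC3 : ¬ ContainsInduced TriangleGraph G) {g : ℕ → V} {val : ℕ → ℕ → Option Bool}
    (hval : IsSoundTable G g val) (ws : List (List ℕ)) : ws.any (excludes val) = false := by
  simp only [List.any_eq_false, Bool.not_eq_true]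
  exact fun w _ => not_excludes hP hC3 hval w

theorem isSoundTable_prefixTable {g : ℕ → V} {rows : List ℕ} (hg : HasRows G g rows) {v : V}
    {k m : ℕ} (hk : k ≤ rows.length) (hv : ∀ a < k, (G.Adj (g a) v ↔ m.testBit a = true)) :
    IsSoundTable G (fun a => if a < rows.length then g a else v) (prefixTable rows k m) := by
  intro a b x hx
  unfold prefixTable at hx
  split_ifs at hx with h1 h2
  · obtain rfl := Option.some.inj hx
    simpa only [if_pos h1.1, if_pos h1.2] using hg a h1.1 b h1.2
  · obtain rfl := Option.some.inj hx
    rcases le_total a b with hab | hab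
    · rw [min_eq_left hab] at h2 ⊢
      have ha : a < rows.length := by omega
      have hb : ¬ b < rows.length := fun hb => h1 ⟨ha, hb⟩
      simpa only [if_pos ha, if_neg hb] using hv a h2
    · rw [min_eq_right hab] at h2 ⊢
      have hb : b < rows.length := by omega
      have ha : ¬ a < rows.length := fun ha => h1 ⟨ha, hb⟩
      simpa only [if_pos hb, if_neg ha, G.adj_comm v] using hv b h2

theorem exists_type_of_partial (hP : ¬ ContainsInduced P2UnionP4 G)
    (hC3 : ¬ ContainsInduced TriangleGraph G) {g : ℕ → V} {rows : List ℕ}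
    (hg : HasRows G g rows) {L : List ℕ} {ws : List (List ℕ)} (v : V) (d k m : ℕ)
    (hk : d + k = rows.length) (hm : m < 2 ^ k)
    (hv : ∀ a < k, (G.Adj (g a) v ↔ m.testBit a = true)) (h : typesCheck rows L ws d k m) :
    ∃ t ∈ L, ∀ a < rows.length, (G.Adj (g a) v ↔ t.testBit a = true) := by
  have hany := any_excludes hP hC3 (isSoundTable_prefixTable hg (by omega) hv) ws
  induction d generalizing k m with
  | zero =>
    simp only [typesCheck, hany, Bool.or_false, List.contains_iff_mem] at h
    exact ⟨m, h, by simpa [← hk] using hv⟩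
  | succ d ih =>
    simp only [typesCheck, hany, Bool.false_or, Bool.and_eq_true] at h
    have hm' : m < 2 ^ (k + 1) := hm.trans (Nat.pow_lt_pow_right one_lt_two k.lt_succ_self)
    have hor : m ||| 2 ^ k < 2 ^ (k + 1) :=
      Nat.or_lt_two_pow hm' (Nat.pow_lt_pow_right one_lt_two k.lt_succ_self)
    have hlt : ∀ a < k + 1, a ≠ k → a < k := fun a ha hne => by omega
    by_cases hadj : G.Adj (g k) v
    · have hv' : ∀ a < k + 1, (G.Adj (g a) v ↔ (m ||| 2 ^ k).testBit a = true) := by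
        intro a ha
        by_cases hak : a = k
        · subst hak
          simp [hadj]
        · rw [hv a (hlt a ha hak)]
          simp [Nat.testBit_or, Ne.symm hak]
      exact ih (k + 1) _ (by omega) hor hv' h.2
        (any_excludes hP hC3 (isSoundTable_prefixTable hg (by omega) hv') ws)
    · have hv' : ∀ a < k + 1, (G.Adj (g a) v ↔ m.testBit a = true) := by
        intro a ha
        by_cases hak : a = k
        · subst hak
          simp [hadj, Nat.testBit_lt_two_pow hm]
        · exact hv a (hlt a ha hak)
      exact ih (k + 1) _ (by omega) hm' hv' h.1
        (any_excludes hP hC3 (isSoundTable_prefixTable hg (by omega) hv') ws)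

theorem exists_type (hP : ¬ ContainsInduced P2UnionP4 G)
    (hC3 : ¬ ContainsInduced TriangleGraph G) {g : ℕ → V} {rows : List ℕ}
    (hg : HasRows G g rows) {L : List ℕ} {ws : List (List ℕ)}
    (h : typesCheck rows L ws rows.length 0 0) (v : V) :
    ∃ t ∈ L, ∀ a < rows.length, (G.Adj (g a) v ↔ t.testBit a = true) :=
  exists_type_of_partial hP hC3 hg v _ 0 0 rfl one_pos (by simp) h

/-- `ty` assigns to each vertex the index of its type. -/
def IsTypeMap (G : SimpleGraph V) (g : ℕ → V) (n : ℕ) (L : List ℕ) (ty : V → ℕ) : Prop :=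
  ∀ v, ty v < L.length ∧ ∀ a < n, (G.Adj (g a) v ↔ rowAdj L (ty v) a = true)

theorem exists_isTypeMap (hP : ¬ ContainsInduced P2UnionP4 G)
    (hC3 : ¬ ContainsInduced TriangleGraph G) {g : ℕ → V} {rows : List ℕ}
    (hg : HasRows G g rows) {L : List ℕ} {ws : List (List ℕ)}
    (h : typesCheck rows L ws rows.length 0 0) : ∃ ty, IsTypeMap G g rows.length L ty := by
  refine Classical.skolem (p := fun v i => i < L.length ∧ ∀ a < rows.length,
    (G.Adj (g a) v ↔ rowAdj L i a = true)).1 fun v => ?_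
  obtain ⟨t, ht, hv⟩ := exists_type hP hC3 hg h v
  obtain ⟨i, hi, rfl⟩ := List.getElem_of_mem ht
  exact ⟨i, hi, by simpa [rowAdj, hi] using hv⟩

theorem pairs_sound (hP : ¬ ContainsInduced P2UnionP4 G)
    (hC3 : ¬ ContainsInduced TriangleGraph G) {g : ℕ → V} {rows : List ℕ}
    (hg : HasRows G g rows) {L T0 T1 : List ℕ} {wp : List (List ℕ)} {ty : V → ℕ}
    (hty : IsTypeMap G g rows.length L ty) (h : pairsCheck rows L T0 T1 wp) (u v : V) :
    (G.Adj u v → rowAdj T1 (ty u) (ty v) = true) ∧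
      (¬ G.Adj u v → rowAdj T0 (ty u) (ty v) = true) := by
  have key : ∀ u v : V, ∀ x : Bool, (G.Adj u v ↔ x = true) → pairExcluded rows wp
      (L.getD (ty u) 0) (L.getD (ty v) 0) x = false := by
    intro u v x hx
    refine any_excludes hP hC3 (g := fun a => if a < rows.length then g a else
      if a = rows.length then u else v) ?_ wp
    have hmask : ∀ a < rows.length, ∀ b, G.Adj (g a) (if b < rows.length then g b else
        if b = rows.length then u else v) ↔
        (pairMask rows (L.getD (ty u) 0) (L.getD (ty v) 0) b).testBit a = true := by
      intro a ha b
      unfold pairMask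
      split_ifs with hb hb'
      · rw [G.adj_comm]
        exact hg b hb a ha
      · exact (hty u).2 a ha
      · exact (hty v).2 a ha
    intro a b y hy
    unfold maskTable at hy
    split_ifs at hy with ha hb
    · obtain rfl := Option.some.inj hy
      simpa only [if_pos ha] using hmask a ha b
    · obtain rfl := Option.some.inj hy
      rw [G.adj_comm]
      simpa only [if_pos hb] using hmask b hb a
    · dsimp only at hy
      split_ifs at hy with hab
      obtain rfl := Option.some.inj hy
      simp only [if_neg ha, if_neg hb]
      rcases hab with ⟨hne, rfl | rfl⟩
      · rwa [if_pos rfl, if_neg (Ne.symm hne)]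
      · rwa [if_pos rfl, if_neg hne, G.adj_comm]
  have hle : ∀ u v : V, ty v ≤ ty u → ∀ x : Bool, (G.Adj u v ↔ x = true) →
      rowAdj (if x then T1 else T0) (ty u) (ty v) = true ∧
        rowAdj (if x then T1 else T0) (ty v) (ty u) = true := by
    intro u v huv x hx
    simp only [pairsCheck, List.all_eq_true, List.mem_range, Bool.or_eq_true,
      Bool.and_eq_true] at h
    refine (h _ (hty u).1 _ (Nat.lt_succ_of_le huv) x (by cases x <;> simp)).resolve_right ?_
    rw [Bool.not_eq_true]
    exact key v u x (by rwa [G.adj_comm])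
  have hall : ∀ x : Bool, (G.Adj u v ↔ x = true) →
      rowAdj (if x then T1 else T0) (ty u) (ty v) = true := by
    intro x hx
    rcases le_total (ty v) (ty u) with huv | huv
    · exact (hle u v huv x hx).1
    · exact (hle v u huv x (by rwa [G.adj_comm])).2
  exact ⟨fun h => hall true (by simpa using h), fun h => hall false (by simpa using h)⟩

end

/-- A proof by cases that a graph with given vertex types is 3-colorable or contains the Grötzsch
graph: `color c` colors each type `i` with `c[i]`, `forb w` points to forbidden or Grötzsch induced
subgraphs, `pres i` distinguishes whether the type `i` occurs, and `edge i j` whether there is an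
edge between the types `i` and `j`. -/
inductive ColoringTree
  | color (c : List ℕ)
  | forb (w : List ℕ)
  | pres (i : ℕ) (yes no : ColoringTree)
  | edge (i j : ℕ) (yes no : ColoringTree)

/-- The adjacency table of `n` root vertices and further vertices, where the vertex `a` is of type
`tys a`, the list `E` consists of edges, `per i j` holds if vertices of types `i` and `j` may be
adjacent and `T0` tells whether they may be nonadjacent. -/
def typeTable (n : ℕ) (L T0 : List ℕ) (tys : ℕ → ℕ) (E : List (ℕ × ℕ)) (per : ℕ → ℕ → Bool) :
    ℕ → ℕ → Option Bool :=
  maskTable n (fun a => L.getD (tys a) 0) fun a b =>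
    if E.contains (a, b) || E.contains (b, a) then some true
    else if !per (tys a) (tys b) then some false
    else if !rowAdj T0 (tys a) (tys b) then some true
    else none

namespace ColoringTree

def check (n : ℕ) (L T0 : List ℕ) : ColoringTree → ℕ → (ℕ → ℕ) → List (ℕ × ℕ) →
    (ℕ → ℕ → Bool) → Bool
  | color c, _, _, _, per => (List.range L.length).all fun i => (List.range L.length).all fun j =>
      !per i j || c.getD i 0 % 3 != c.getD j 0 % 3
  | forb w, _, tys, E, per => hits (typeTable n L T0 tys E per) grotzschRows w ||
      excludes (typeTable n L T0 tys E per) w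
  | pres i yes no, k, tys, E, per =>
      check n L T0 yes (k + 1) (fun a => if a = k then i else tys a) E per &&
      check n L T0 no k tys E fun a b => per a b && a != i && b != i
  | edge i j yes no, k, tys, E, per =>
      check n L T0 yes (k + 2) (fun a => if a = k then i else if a = k + 1 then j else tys a)
        ((k, k + 1) :: E) per &&
      check n L T0 no k tys E fun a b => per a b && !(a == i && b == j) && !(a == j && b == i)

variable {V : Type*} {G : SimpleGraph V}

theorem sound (hP : ¬ ContainsInduced P2UnionP4 G) (hC3 : ¬ ContainsInduced TriangleGraph G)
    {n : ℕ} {L T0 : List ℕ} {ty : V → ℕ}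
    (hT0 : ∀ u v, ¬ G.Adj u v → rowAdj T0 (ty u) (ty v) = true) (t : ColoringTree)
    {g : ℕ → V} (hty : IsTypeMap G g n L ty) {k : ℕ} (hk : n ≤ k) {tys : ℕ → ℕ}
    (htys : ∀ a, ty (g a) = tys a) {E : List (ℕ × ℕ)}
    (hE : ∀ e ∈ E, e.1 < k ∧ e.2 < k ∧ G.Adj (g e.1) (g e.2)) {per : ℕ → ℕ → Bool}
    (hper : ∀ u v, G.Adj u v → per (ty u) (ty v) = true) (h : t.check n L T0 k tys E per) :
    ContainsInduced GrotzschGraph G ∨ G.Colorable 3 := by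
  induction t generalizing g k tys E per with
  | color c =>
    refine .inr ⟨Coloring.mk (fun v => (Fin.ofNat 3 (c.getD (ty v) 0))) fun {u v} huv => ?_⟩
    simp only [check, List.all_eq_true, List.mem_range, Bool.or_eq_true, Bool.not_eq_true',
      bne_iff_ne] at h
    have := (h _ (hty u).1 _ (hty v).1).resolve_left (by simp [hper u v huv])
    simpa [Fin.ext_iff] using this
  | forb w =>
    have hval : IsSoundTable G g (typeTable n L T0 tys E per) := by
      intro a b x hx
      unfold typeTable maskTable at hx
      split_ifs at hx with ha hb
      · obtain rfl := Option.some.inj hx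
        simp only [← htys]
        exact (hty _).2 a ha
      · obtain rfl := Option.some.inj hx
        simp only [← htys]
        rw [G.adj_comm]
        exact (hty _).2 b hb
      · dsimp only at hx
        split_ifs at hx with h1 h2 h3 <;> obtain rfl := Option.some.inj hx
        · simp only [Bool.or_eq_true, List.contains_iff_mem] at h1
          rcases h1 with h1 | h1
          · simpa using (hE _ h1).2.2
          · simpa using (hE _ h1).2.2.symm
        · rw [← htys, ← htys, Bool.not_eq_true'] at h2
          simpa using fun hadj => by simpa [h2] using hper _ _ hadj
        · rw [← htys, ← htys, Bool.not_eq_true'] at h3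
          by_contra hadj
          simpa [h3] using hT0 (g a) (g b) (by simpa using hadj)
    rw [check, not_excludes hP hC3 hval, Bool.or_false] at h
    exact .inl (containsInduced_grotzschGraph (hits_adj hval h (by decide +kernel)))
  | pres i yes no ihy ihn =>
    rw [check, Bool.and_eq_true] at h
    by_cases hi : ∃ v, ty v = i
    · obtain ⟨v, rfl⟩ := hi
      refine ihy (g := fun a => if a = k then v else g a) ?_ (k := k + 1) (by omega) ?_ ?_ hper h.1
      · refine fun u => ⟨(hty u).1, fun a ha => ?_⟩
        simpa only [if_neg (show a ≠ k by omega)] using (hty u).2 a ha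
      · intro a
        split_ifs
        · rfl
        · exact htys a
      · intro e he
        obtain ⟨h1, h2, h3⟩ := hE e he
        exact ⟨by omega, by omega, by simpa only [if_neg h1.ne, if_neg h2.ne] using h3⟩
    · push Not at hi
      refine ihn hty hk htys hE (fun u v huv => ?_) h.2
      simp [hper u v huv, hi]
  | edge i j yes no ihy ihn =>
    rw [check, Bool.and_eq_true] at h
    by_cases hij : ∃ u v, G.Adj u v ∧ ty u = i ∧ ty v = j
    · obtain ⟨u, v, huv, rfl, rfl⟩ := hij
      refine ihy (g := fun a => if a = k then u else if a = k + 1 then v else g a) ?_ (k := k + 2)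
        (by omega) ?_ ?_ hper h.1
      · refine fun u => ⟨(hty u).1, fun a ha => ?_⟩
        simpa only [if_neg (show a ≠ k by omega), if_neg (show a ≠ k + 1 by omega)] using
          (hty u).2 a ha
      · intro a
        split_ifs
        · rfl
        · rfl
        · exact htys a
      · intro e he
        rcases List.mem_cons.1 he with rfl | he
        · simpa using huv
        · obtain ⟨h1, h2, h3⟩ := hE e he
          refine ⟨by omega, by omega, ?_⟩
          simpa only [if_neg h1.ne, if_neg h2.ne, if_neg (show e.1 ≠ k + 1 by omega),
            if_neg (show e.2 ≠ k + 1 by omega)] using h3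
    · push Not at hij
      refine ihn hty hk htys hE (fun u v huv => ?_) h.2
      have h1 := hij u v huv
      have h2 := hij v u huv.symm
      simp only [hper u v huv, Bool.true_and, Bool.and_eq_true, Bool.not_eq_true',
        Bool.and_eq_false_iff, beq_eq_false_iff_ne]
      tauto

end ColoringTree

/-- The types of the root vertices of `octadRows`. -/
def octadRootTypes : List ℕ := [11, 13, 10, 14, 3, 15, 4, 6]

def octadTree : ColoringTree :=
  .pres 7
    (.pres 9
      (.edge 15 3
        (.forb [8, 10, 11])
        (.edge 15 5
          (.forb [3, 4, 7, 9, 11, 2, 0, 1, 8, 5, 6])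
          (.edge 16 3
            (.forb [6, 2, 10, 9, 0, 5, 1, 7, 3, 4, 8])
            (.edge 12 9
              (.pres 2
                (.pres 16
                  (.forb [7, 1, 3, 5, 10, 13, 0, 4, 8, 11, 6])
                  (.pres 5
                    (.forb [3, 4, 7, 9, 13, 2, 0, 1, 8, 5, 6])
                    (.pres 8
                      (.forb [2, 1, 3, 12, 6, 13, 0, 4, 8, 11, 10])
                      (.color [2, 2, 0, 0, 2, 0, 1, 2, 0, 1, 1, 1, 2, 0, 2, 0, 0]))))
                (.pres 1
                  (.pres 8
                    (.forb [11, 6, 12, 3, 10, 8, 0, 1, 2, 13, 4])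
                    (.color [2, 2, 0, 1, 0, 1, 2, 2, 0, 1, 1, 2, 0, 0, 0, 1, 1]))
                  (.color [2, 0, 0, 0, 1, 0, 2, 2, 2, 0, 0, 2, 1, 1, 1, 0, 0])))
              (.color [2, 0, 1, 2, 1, 2, 0, 0, 1, 2, 0, 0, 2, 1, 1, 2, 2])))))
      (.pres 8
        (.edge 15 3
          (.forb [8, 10, 11])
          (.edge 15 5
            (.forb [5, 6, 7, 9, 11, 8, 0, 1, 2, 3, 4])
            (.edge 16 3
              (.forb [4, 0, 9, 10, 8, 3, 1, 2, 6, 5, 7])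
              (.color [2, 0, 1, 2, 1, 2, 0, 0, 1, 0, 0, 0, 2, 1, 1, 2, 2]))))
        (.pres 16
          (.pres 2
            (.pres 5
              (.pres 12
                (.forb [10, 12, 2, 9, 11, 8, 0, 1, 7, 3, 4])
                (.pres 1
                  (.forb [9, 6, 7, 10, 4, 12, 0, 1, 2, 3, 11])
                  (.color [2, 0, 0, 0, 0, 1, 1, 1, 0, 0, 1, 2, 0, 0, 2, 2, 2])))
              (.color [2, 0, 1, 1, 1, 0, 0, 0, 0, 0, 0, 0, 2, 1, 2, 2, 2]))
            (.color [2, 1, 0, 0, 0, 0, 1, 1, 0, 0, 1, 1, 0, 0, 2, 2, 2]))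
          (.color [2, 2, 2, 1, 1, 0, 0, 0, 0, 0, 0, 2, 1, 1, 2, 2, 0]))))
    (.pres 12
      (.pres 8
        (.edge 15 3
          (.forb [9, 10, 11])
          (.edge 15 5
            (.forb [0, 1, 11, 8, 6, 4, 2, 3, 7, 5, 9])
            (.edge 16 3
              (.forb [7, 8, 3, 5, 1, 10, 0, 4, 9, 2, 6])
              (.pres 1
                (.edge 12 9
                  (.pres 16
                    (.forb [9, 8, 10, 5, 4, 2, 0, 1, 7, 13, 6])
                    (.pres 5
                      (.forb [9, 8, 2, 5, 4, 10, 0, 1, 7, 3, 13])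
                      (.color [2, 0, 2, 0, 1, 0, 2, 0, 2, 2, 0, 2, 1, 1, 1, 0, 0])))
                  (.color [2, 0, 1, 2, 1, 2, 0, 0, 1, 2, 0, 0, 2, 1, 1, 2, 2]))
                (.color [2, 0, 2, 0, 1, 0, 2, 0, 2, 0, 0, 2, 1, 1, 1, 0, 0])))))
        (.pres 16
          (.pres 5
            (.pres 2
              (.forb [7, 1, 9, 3, 8, 5, 0, 6, 2, 11, 10])
              (.pres 9
                (.pres 1
                  (.forb [3, 10, 7, 11, 4, 2, 0, 1, 12, 9, 6])
                  (.color [0, 0, 0, 0, 0, 0, 0, 0, 0, 1, 1, 1, 2, 2, 2, 1, 1]))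
                (.color [2, 0, 0, 1, 1, 1, 0, 0, 0, 0, 0, 0, 1, 1, 2, 2, 2])))
            (.color [2, 2, 2, 2, 1, 0, 2, 0, 0, 0, 0, 0, 1, 1, 1, 0, 0]))
          (.color [2, 2, 2, 0, 1, 0, 0, 0, 0, 0, 0, 2, 1, 1, 1, 2, 0])))
      (.pres 16
        (.pres 5
          (.pres 1
            (.pres 9
              (.forb [3, 9, 7, 11, 4, 2, 0, 1, 10, 8, 6])
              (.pres 2
                (.forb [8, 6, 7, 11, 4, 10, 0, 1, 2, 3, 9])
                (.color [2, 0, 0, 0, 1, 1, 0, 0, 1, 0, 0, 2, 0, 1, 2, 2, 2])))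
            (.color [2, 0, 1, 0, 1, 0, 0, 0, 1, 0, 0, 2, 0, 1, 1, 2, 2]))
          (.color [2, 0, 1, 0, 1, 0, 0, 0, 1, 2, 0, 2, 0, 1, 1, 2, 2]))
        (.color [2, 2, 1, 0, 1, 0, 0, 0, 1, 0, 0, 2, 0, 1, 1, 2, 0])))

theorem octadTree_check : octadTree.check 8 octadTypes octadMayMiss 8
    (fun a => octadRootTypes.getD a 11) [] (rowAdj octadMayMeet) := by
  decide +kernel

section

variable {V : Type*} {G : SimpleGraph V}

theorem HasRows.congr {g g' : ℕ → V} {rows : List ℕ} (hg : HasRows G g rows)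
    (h : ∀ a < rows.length, g' a = g a) : HasRows G g' rows := by
  intro a ha b hb
  rw [h a ha, h b hb]
  exact hg a ha b hb

theorem grotzsch_or_colorable_of_octad (hP : ¬ ContainsInduced P2UnionP4 G)
    (hC3 : ¬ ContainsInduced TriangleGraph G) {g : ℕ → V} (hg : HasRows G g octadRows) :
    ContainsInduced GrotzschGraph G ∨ G.Colorable 3 := by
  have hg' : HasRows G (fun a => if a < 8 then g a else g 0) octadRows :=
    hg.congr fun a ha => if_pos ha
  obtain ⟨ty, hty⟩ := exists_isTypeMap hP hC3 hg' octad_typesCheck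
  have hpair := pairs_sound hP hC3 hg' hty octad_pairsCheck
  have hroot : ∀ a < 8, ty (g a) = octadRootTypes.getD a 11 := by
    have hdec : ∀ a < 8, ∀ i < 17, (∀ b < 8, rowAdj octadTypes i b = rowAdj octadRows a b) →
        i = octadRootTypes.getD a 11 := by decide +kernel
    refine fun a ha => hdec a ha _ (hty _).1 fun b hb => ?_
    have h1 := (hty (g a)).2 b hb
    simp only [if_pos hb] at h1
    rw [Bool.eq_iff_iff, ← h1, G.adj_comm]
    exact hg a ha b hb
  refine octadTree.sound hP hC3 (fun u v => (hpair u v).2) hty le_rfl (fun a => ?_) (by simp)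
    (fun u v => (hpair u v).1) octadTree_check
  split_ifs with ha
  · exact hroot a ha
  · have hdef : octadRootTypes.getD a 11 = 11 :=
      List.getD_eq_default _ _ (by simpa [octadRootTypes] using ha)
    rw [hroot 0 (by omega), hdef]
    rfl

/-- The point of `(ℤ/2)⁴` whose coordinates are the binary digits of `c`. -/
def clebschPoint (c : ℕ) : Fin 4 → ZMod 2 := fun i => if c.testBit i then 1 else 0

/-- The codes of the points of the Clebsch graph that correspond to `grotzschTypes`, except for the
type `0`. -/
def clebschCodes : List ℕ := [0, 0, 3, 5, 11, 8, 13, 7, 4, 14, 2, 9, 10, 15, 12, 1, 6]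

theorem clebschGraph_adj (x y : Fin 4 → ZMod 2) : ClebschGraph.Adj x y ↔
    x - y ∈ ({Pi.single 0 1, Pi.single 1 1, Pi.single 2 1, Pi.single 3 1, 1} :
      Finset (Fin 4 → ZMod 2)) := by
  revert x y
  simp only [ClebschGraph, fromRel_adj, Finset.mem_insert, Finset.mem_singleton,
    Set.mem_insert_iff, Set.mem_singleton_iff]
  decide +kernel

theorem clebschGraph_adj_iff (i j : Fin 17) (hi : i ≠ 0) (hj : j ≠ 0) :
    ClebschGraph.Adj (clebschPoint (clebschCodes.getD i 0))
      (clebschPoint (clebschCodes.getD j 0)) ↔ rowAdj grotzschMayMeet i j = true := by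
  rw [clebschGraph_adj]
  revert i j
  decide +kernel

theorem containsInduced_clebschGraph (hP : ¬ ContainsInduced P2UnionP4 G)
    (hC3 : ¬ ContainsInduced TriangleGraph G)
    (hcomp : ∀ u v, u ≠ v → ¬ G.Adj u v → ∃ w, G.Adj u w ∧ ¬ G.Adj v w)
    {g : ℕ → V} (hg : HasRows G g grotzschRows) : ContainsInduced G ClebschGraph := by
  obtain ⟨ty, hty⟩ := exists_isTypeMap hP hC3 hg grotzsch_typesCheck
  have hpair := pairs_sound hP hC3 hg hty grotzsch_pairsCheck
  have hadj : ∀ u v, G.Adj u v ↔ rowAdj grotzschMayMeet (ty u) (ty v) = true := by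
    have hdec : ∀ i < 17, ∀ j < 17, rowAdj grotzschMayMiss i j = true →
        rowAdj grotzschMayMeet i j = false := by decide +kernel
    refine fun u v => ⟨(hpair u v).1, fun h => ?_⟩
    by_contra huv
    simp [hdec _ (hty u).1 _ (hty v).1 ((hpair u v).2 huv)] at h
  have hne : ∀ v, ty v ≠ 0 := by
    intro v hv
    have hdec : ∀ j < 17, rowAdj grotzschMayMeet 0 j = false := by decide +kernel
    have hiso : ∀ w, ¬ G.Adj v w := by
      intro w
      rw [hadj, hv, hdec _ (hty w).1]
      simp
    have h01 : G.Adj (g 0) (g 1) := (hg 0 (by decide) 1 (by decide)).2 (by decide)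
    obtain ⟨w, hw, -⟩ := hcomp v (g 0) (fun h => hiso (g 1) (h ▸ h01)) (hiso _)
    exact hiso w hw
  have hiff : ∀ u v, ClebschGraph.Adj (clebschPoint (clebschCodes.getD (ty u) 0))
      (clebschPoint (clebschCodes.getD (ty v) 0)) ↔ G.Adj u v := by
    intro u v
    rw [hadj]
    exact clebschGraph_adj_iff ⟨ty u, (hty u).1⟩ ⟨ty v, (hty v).1⟩
      (by simpa [Fin.ext_iff] using hne u) (by simpa [Fin.ext_iff] using hne v)
  refine ⟨⟨fun v => clebschPoint (clebschCodes.getD (ty v) 0), fun u v huv => ?_⟩, hiff⟩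
  by_contra huv'
  simp only at huv
  obtain ⟨w, hw, hw'⟩ := hcomp u v huv' (by rw [← hiff, huv]; exact ClebschGraph.irrefl)
  rw [← hiff, huv, hiff] at hw
  exact hw' hw

/-- A closed walk of odd length `n` that avoids the neighborhood of `z`. -/
def IsOddClosedWalk (G : SimpleGraph V) (z : V) (n : ℕ) (f : ℕ → V) : Prop :=
  Odd n ∧ (∀ i < n, G.Adj (f i) (f (i + 1))) ∧ f n = f 0 ∧ ∀ i ≤ n, ¬ G.Adj z (f i)

theorem not_adj_of_adj_of_adj (hC3 : ¬ ContainsInduced TriangleGraph G) {a b c : V}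
    (hab : G.Adj a b) (hbc : G.Adj b c) : ¬ G.Adj a c := by
  intro hac
  refine hC3 (containsInduced_triangleGraph (g := fun i => if i = 0 then a else
    if i = 1 then b else c) ?_)
  intro i hi j hj
  change i < 3 at hi
  change j < 3 at hj
  interval_cases i <;> interval_cases j <;>
    simp [rowAdj, triangleRows, hab, hbc, hac, hab.symm, hbc.symm, hac.symm, Nat.testBit]

theorem exists_isOddClosedWalk (h3 : ¬ G.Colorable 3) (hC3 : ¬ ContainsInduced TriangleGraph G)
    (z : V) : ∃ n f, IsOddClosedWalk G z n f := by
  classical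
  by_contra! hno
  apply h3
  have h2 : (G.induce {v | ¬ G.Adj z v}).Colorable 2 := by
    rw [two_colorable_iff_forall_loop_even]
    intro u w
    by_contra hw
    refine hno w.length (fun i => (w.getVert i).1)
      ⟨Nat.not_even_iff_odd.1 hw, fun i hi => w.adj_getVert_succ hi, by simp, fun i _ => ?_⟩
    exact (w.getVert i).2
  obtain ⟨C⟩ := h2
  refine ⟨Coloring.mk (fun v => if h : ¬ G.Adj z v then (C ⟨v, h⟩).castSucc else 2) ?_⟩
  intro u v huv
  by_cases hu : G.Adj z u <;> by_cases hv : G.Adj z v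
  · exact (not_adj_of_adj_of_adj hC3 hu huv hv).elim
  · simpa [hu, hv] using (Fin.castSucc_lt_last (C ⟨v, hv⟩)).ne'
  · simpa [hu, hv] using (Fin.castSucc_lt_last (C ⟨u, hu⟩)).ne
  · have : C ⟨u, hu⟩ ≠ C ⟨v, hv⟩ := C.valid huv
    simpa [hu, hv] using this

def cycleAdj (n i j : ℕ) : Bool :=
  i + 1 == j || j + 1 == i || (i == 0 && j + 1 == n) || (j == 0 && i + 1 == n)

theorem exists_induced_odd_cycle (h3 : ¬ G.Colorable 3)
    (hC3 : ¬ ContainsInduced TriangleGraph G) (z : V) :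
    ∃ (n : ℕ) (f : ℕ → V), Odd n ∧ 5 ≤ n ∧
      (∀ i < n, ∀ j < n, (G.Adj (f i) (f j) ↔ cycleAdj n i j = true)) ∧
        ∀ i < n, ¬ G.Adj z (f i) := by
  classical
  have hex := exists_isOddClosedWalk h3 hC3 z
  obtain ⟨f, hodd, hstep, hclose, hz⟩ := Nat.find_spec hex
  have hmin : ∀ m < Nat.find hex, ∀ f, ¬ IsOddClosedWalk G z m f := by
    intro m hm f hf
    exact Nat.find_min hex hm ⟨f, hf⟩
  generalize Nat.find hex = n at *
  have hchord : ∀ i j, i + 2 ≤ j → j < n → j - i + 2 ≤ n → ¬ G.Adj (f i) (f j) := by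
    intro i j hij hj hjn hadj
    rcases Nat.even_or_odd (j - i) with he | ho
    · refine hmin (j - i + 1) (by omega) (fun t => if t ≤ j - i then f (i + t) else f i)
        ⟨he.add_one, fun t ht => ?_, by simp, fun t ht => ?_⟩
      · dsimp only
        rw [if_pos (by omega)]
        split_ifs with h
        · exact hstep (i + t) (by omega)
        · rw [show i + t = j by omega]
          exact hadj.symm
      · dsimp only
        split_ifs
        · exact hz _ (by omega)
        · exact hz _ (by omega)
    · refine hmin (n - (j - i) + 1) (by omega) (fun t => if t ≤ i then f t else f (t + (j - i) - 1))
        ⟨(Nat.Odd.sub_odd hodd ho).add_one, fun t ht => ?_, ?_, fun t ht => ?_⟩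
      · dsimp only
        split_ifs with h1 h2 h2
        · exact hstep t (by omega)
        · rw [show t = i by omega, show i + 1 + (j - i) - 1 = j by omega]
          exact hadj
        · omega
        · rw [show t + 1 + (j - i) - 1 = t + (j - i) - 1 + 1 by omega]
          exact hstep _ (by omega)
      · dsimp only
        rw [if_neg (by omega), if_pos (by omega),
          show n - (j - i) + 1 + (j - i) - 1 = n by omega, hclose]
      · dsimp only
        split_ifs
        · exact hz _ (by omega)
        · exact hz _ (by omega)
  have hlt : ∀ i j, i < j → j < n → (G.Adj (f i) (f j) ↔ cycleAdj n i j = true) := by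
    intro i j hij hj
    simp only [cycleAdj, Bool.or_eq_true, Bool.and_eq_true, beq_iff_eq]
    constructor
    · intro hadj
      by_contra hne
      exact hchord i j (by omega) hj (by omega) hadj
    · rintro (((rfl | h) | ⟨rfl, rfl⟩) | h)
      · exact hstep i (by omega)
      · omega
      · rw [← hclose]
        exact (hstep j (by omega)).symm
      · omega
  have hn : 5 ≤ n := by
    by_contra hn
    obtain ⟨k, rfl⟩ := hodd
    have hk : k = 0 ∨ k = 1 := by omega
    rcases hk with rfl | rfl
    · have := hstep 0 (by omega)
      rw [show 0 + 1 = 2 * 0 + 1 from rfl, hclose] at this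
      exact this.ne rfl
    · exact not_adj_of_adj_of_adj hC3 (hstep 0 (by omega)) (hstep 1 (by omega))
        ((hlt 0 2 (by omega) (by omega)).2 (by decide))
  refine ⟨n, f, hodd, hn, fun i hi j hj => ?_, fun i hi => hz i hi.le⟩
  rcases lt_trichotomy i j with hij | rfl | hij
  · exact hlt i j hij hj
  · refine iff_of_false G.irrefl ?_
    simp only [cycleAdj, Bool.or_eq_true, Bool.and_eq_true, beq_iff_eq]
    omega
  · rw [G.adj_comm, hlt j i hij hi]
    simp only [cycleAdj, Bool.or_eq_true, Bool.and_eq_true, beq_iff_eq]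
    omega

end

section

variable {V : Type*} {G : SimpleGraph V}

/-- A root consisting of an induced cycle and a vertex anticomplete to it. -/
theorem hasRows_of_cycle {n : ℕ} {f : ℕ → V} {z : V} {rows : List ℕ} (hlen : rows.length = n + 1)
    (hf : ∀ i < n, ∀ j < n, (G.Adj (f i) (f j) ↔ cycleAdj n i j = true))
    (hz : ∀ i < n, ¬ G.Adj z (f i))
    (hrows : ∀ i < n + 1, ∀ j < n + 1,
      rowAdj rows i j = (decide (i < n) && decide (j < n) && cycleAdj n i j)) :
    HasRows G (fun a => if a < n then f a else z) rows := by
  intro a ha b hb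
  rw [hlen] at ha hb
  rw [hrows a ha b hb]
  dsimp only
  split_ifs with h1 h2 h2
  · simpa [h1, h2] using hf a h1 b h2
  · simpa [h1, h2, G.adj_comm] using hz a h1
  · simpa [h1, h2] using hz b h2
  · simp [h1]

/-- If `t` runs through the types of the neighbors of `z`, then two cyclically consecutive ones
occur. -/
theorem exists_consecutive_types (p : ℕ → Prop)
    (h : ∀ i < 5, ∃ t ∈ [37, 41, 42, 50, 52], p t ∧ Nat.testBit t i = false) :
    p 37 ∧ p 42 ∨ p 42 ∧ p 52 ∨ p 52 ∧ p 41 ∨ p 41 ∧ p 50 ∨ p 50 ∧ p 37 := by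
  have h0 := h 0 (by omega)
  have h1 := h 1 (by omega)
  have h2 := h 2 (by omega)
  have h3 := h 3 (by omega)
  have h4 := h 4 (by omega)
  simp [Nat.testBit] at h0 h1 h2 h3 h4
  tauto

theorem hasRows_octad {g : ℕ → V} (hg : HasRows G g pentagonRows) {x y : V} {s t : ℕ}
    (hx : ∀ a < 6, (G.Adj (g a) x ↔ s.testBit a = true))
    (hy : ∀ a < 6, (G.Adj (g a) y ↔ t.testBit a = true)) (hxy : ¬ G.Adj x y) {w : List ℕ}
    (h : hits (maskTable 6 (pairMask pentagonRows s t) fun _ _ => some false) octadRows w) :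
    ∃ g', HasRows G g' octadRows := by
  refine ⟨_, hits_adj (g := fun a => if a < 6 then g a else if a = 6 then x else y) ?_ h
    (by decide)⟩
  have hmask : ∀ a < 6, ∀ b, G.Adj (g a) (if b < 6 then g b else if b = 6 then x else y) ↔
      (pairMask pentagonRows s t b).testBit a = true := by
    intro a ha b
    unfold pairMask
    change _ ↔ (if b < 6 then _ else if b = 6 then s else t).testBit a = true
    split_ifs with hb hb'
    · rw [G.adj_comm]
      exact hg b hb a ha
    · exact hx a ha
    · exact hy a ha
  intro a b c hc
  unfold maskTable at hc
  split_ifs at hc with ha hb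
  · obtain rfl := Option.some.inj hc
    simpa only [if_pos ha] using hmask a ha b
  · obtain rfl := Option.some.inj hc
    rw [G.adj_comm]
    simpa only [if_pos hb] using hmask b hb a
  · obtain rfl := Option.some.inj hc
    simp only [if_neg ha, if_neg hb]
    refine iff_of_false ?_ Bool.false_ne_true
    split_ifs
    · exact G.irrefl
    · exact hxy
    · rwa [G.adj_comm]
    · exact G.irrefl

theorem exists_octad (hP : ¬ ContainsInduced P2UnionP4 G)
    (hC3 : ¬ ContainsInduced TriangleGraph G) (h3 : ¬ G.Colorable 3)
    (hcomp : ∀ u v, u ≠ v → ¬ G.Adj u v → ∃ w, G.Adj u w ∧ ¬ G.Adj v w) (z : V) :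
    ∃ g, HasRows G g octadRows := by
  obtain ⟨n, f, hodd, hn, hf, hz⟩ := exists_induced_odd_cycle h3 hC3 z
  have hlt : n < 9 := by
    by_contra hn9
    have hval : IsSoundTable G f fun a b =>
        if a < 7 ∧ b < 7 then some (a + 1 == b || b + 1 == a) else none := by
      intro a b x hx
      dsimp only at hx
      split_ifs at hx with hab
      obtain rfl := Option.some.inj hx
      rw [hf a (by omega) b (by omega)]
      simp only [cycleAdj, Bool.or_eq_true, Bool.and_eq_true, beq_iff_eq]
      omega
    have := not_excludes hP hC3 hval [0, 1, 3, 4, 5, 6]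
    exact absurd this (by decide)
  have hzf : ∀ i < n, z ≠ f i := by
    rintro i hi rfl
    have hj : ∃ j < n, cycleAdj n i j = true := by
      by_cases h : i + 1 < n
      · exact ⟨i + 1, h, by simp [cycleAdj]⟩
      · exact ⟨0, by omega, by simp [cycleAdj, show i + 1 = n by omega]⟩
    obtain ⟨j, hj, hij⟩ := hj
    exact hz j hj ((hf i hi j hj).2 hij)
  have hn57 : n = 5 ∨ n = 7 := by
    obtain ⟨k, rfl⟩ := hodd
    omega
  rcases hn57 with rfl | rfl
  · have hg := hasRows_of_cycle (rows := pentagonRows) rfl hf hz (by decide)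
    have hdec : ∀ t ∈ pentagonTypes, t.testBit 5 = true → t ∈ [37, 41, 42, 50, 52] := by decide
    have htypes : ∀ x, G.Adj z x → ∃ t ∈ [37, 41, 42, 50, 52],
        ∀ a < 6, (G.Adj (if a < 5 then f a else z) x ↔ Nat.testBit t a = true) := by
      intro x hx
      obtain ⟨t, ht, hxt⟩ := exists_type hP hC3 hg pentagon_typesCheck x
      have h5 : t.testBit 5 = true := (hxt 5 (by decide)).1 (by simpa using hx)
      exact ⟨t, hdec t ht h5, hxt⟩
    have hcons := exists_consecutive_types (fun t => ∃ x, G.Adj z x ∧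
      ∀ a < 6, (G.Adj (if a < 5 then f a else z) x ↔ Nat.testBit t a = true)) (by
        intro i hi
        obtain ⟨x, hzx, hix⟩ := hcomp z (f i) (hzf i hi) (hz i hi)
        obtain ⟨t, ht, hxt⟩ := htypes x hzx
        refine ⟨t, ht, ⟨x, hzx, hxt⟩, ?_⟩
        rw [← Bool.not_eq_true, ← hxt i (by omega), if_pos hi]
        exact hix)
    have hfin : ∀ s t : ℕ, ∀ w : List ℕ,
        hits (maskTable 6 (pairMask pentagonRows s t) fun _ _ => some false) octadRows w →
        ((∃ x, G.Adj z x ∧ ∀ a < 6, (G.Adj (if a < 5 then f a else z) x ↔ s.testBit a = true)) ∧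
        ∃ x, G.Adj z x ∧ ∀ a < 6, (G.Adj (if a < 5 then f a else z) x ↔ t.testBit a = true)) →
        ∃ g, HasRows G g octadRows := by
      rintro s t w hw ⟨⟨x, hzx, hx⟩, y, hzy, hy⟩
      exact hasRows_octad hg hx hy (not_adj_of_adj_of_adj hC3 hzx.symm hzy) hw
    rcases hcons with h | h | h | h | h
    · exact hfin _ _ [0, 1, 2, 3, 4, 5, 6, 7] (by decide) h
    · exact hfin _ _ [1, 2, 3, 4, 0, 5, 6, 7] (by decide) h
    · exact hfin _ _ [2, 3, 4, 0, 1, 5, 6, 7] (by decide) h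
    · exact hfin _ _ [3, 4, 0, 1, 2, 5, 6, 7] (by decide) h
    · exact hfin _ _ [4, 0, 1, 2, 3, 5, 6, 7] (by decide) h
  · obtain ⟨x, hzx, -⟩ := hcomp z (f 0) (hzf 0 (by omega)) (hz 0 (by omega))
    have hg := hasRows_of_cycle (rows := heptagonRows) rfl hf hz (by decide)
    obtain ⟨t, ht, hxt⟩ := exists_type hP hC3 hg heptagon_typesCheck x
    have h7 : t.testBit 7 = true := (hxt 7 (by decide)).1 (by simpa using hzx)
    have hdec : ∀ t ∈ heptagonTypes, t.testBit 7 = false := by decide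
    simp [hdec t ht] at h7

end

theorem statement_3 {V : Type*} [Fintype V] (G : SimpleGraph V)
    (hconn : G.Connected)
    (hP : ¬ ContainsInduced P2UnionP4 G)
    (hC3 : ¬ ContainsInduced TriangleGraph G) :
    (∃ u v : V, u ≠ v ∧ ¬ G.Adj u v ∧ G.neighborSet u ⊆ G.neighborSet v) ∨
    G.chromaticNumber ≤ 3 ∨
    (ContainsInduced GrotzschGraph G ∧ ContainsInduced G ClebschGraph) := by
  by_cases h3 : G.Colorable 3
  · exact .inr (.inl (chromaticNumber_le_iff_colorable.2 h3))
  by_cases hcomp : ∃ u v : V, u ≠ v ∧ ¬ G.Adj u v ∧ G.neighborSet u ⊆ G.neighborSet v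
  · exact .inl hcomp
  have hcomp' : ∀ u v, u ≠ v → ¬ G.Adj u v → ∃ w, G.Adj u w ∧ ¬ G.Adj v w := by
    intro u v hne huv
    by_contra! hsub
    exact hcomp ⟨u, v, hne, huv, hsub⟩
  obtain ⟨z⟩ := hconn.nonempty
  obtain ⟨g, hg⟩ := exists_octad hP hC3 h3 hcomp' z
  have hF := (grotzsch_or_colorable_of_octad hP hC3 hg).resolve_right h3
  obtain ⟨f, hf⟩ := id hF
  refine .inr (.inr ⟨hF, containsInduced_clebschGraph hP hC3 hcomp'
    (g := fun i => f (Fin.ofNat 11 i)) fun i hi j hj => ?_⟩)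
  change i < 11 at hi
  change j < 11 at hj
  rw [hf, grotzschGraph_adj_iff]
  simp [Nat.mod_eq_of_lt hi, Nat.mod_eq_of_lt hj]
end

section
/- Every (P2∪P4, C3)-free simple graph G satisfies χ(G) ≤ 4. -/
open SimpleGraph

/-- A triangle-free graph in which every path on four vertices closes up to a 4-cycle
is bipartite. -/
theorem SimpleGraph.colorable_two_of_triangleFree_of_pathFour {W : Type*} (H : SimpleGraph W)
    (h3 : ∀ a b c, H.Adj a b → H.Adj b c → ¬ H.Adj a c)
    (h4 : ∀ a b c d, a ≠ c → b ≠ d → H.Adj a b → H.Adj b c → H.Adj c d → H.Adj a d) :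
    H.Colorable 2 := by
  classical
  have dist_le_two : ∀ r x, H.Reachable x r → x = r ∨ H.Adj x r ∨ ∃ a, H.Adj x a ∧ H.Adj a r := by
    rintro r x ⟨p⟩
    induction p with
    | nil => exact Or.inl rfl
    | @cons y x r hyx p ih =>
      rcases ih with rfl | h | ⟨a, hxa, har⟩
      · exact Or.inr (Or.inl hyx)
      · exact Or.inr (Or.inr ⟨x, hyx, h⟩)
      · by_cases hya : y = a
        · subst hya
          exact Or.inr (Or.inl har)
        by_cases hxr : x = r
        · subst hxr
          exact Or.inr (Or.inl hyx)
        exact Or.inr (Or.inl (h4 y x a r hya hxr hyx hxa har))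
  let rep : W → W := fun x => (H.connectedComponentMk x).out
  have reachable_rep : ∀ x, H.Reachable x (rep x) := fun x =>
    (ConnectedComponent.exact (Quot.out_eq (H.connectedComponentMk x))).symm
  have hcol : ∀ {x y}, H.Adj x y → decide (H.Adj x (rep x)) ≠ decide (H.Adj y (rep y)) := by
    intro x y hxy heq
    have hrep : rep x = rep y := by
      simp only [rep, ConnectedComponent.sound hxy.reachable]
    rw [← hrep, decide_eq_decide] at heq
    by_cases hx : H.Adj x (rep x)
    · exact h3 x y (rep x) hxy (heq.1 hx) hx
    have hy : ¬ H.Adj y (rep x) := fun h => hx (heq.2 h)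
    rcases dist_le_two _ _ (reachable_rep x) with h | h | ⟨a, hxa, har⟩
    · exact hy (h ▸ hxy.symm)
    · exact hx h
    · have hya : y ≠ a := fun h => hy (h ▸ har)
      have hxr : x ≠ rep x := fun h => hy (h ▸ hxy.symm)
      exact hy (h4 y x a (rep x) hya hxr hxy.symm hxa har)
  simpa using (Coloring.mk (fun x => decide (H.Adj x (rep x))) hcol).colorable

theorem not_adj_of_not_containsInduced_triangle {V : Type*} {G : SimpleGraph V}
    (hC3 : ¬ ContainsInduced TriangleGraph G) (a b c : V) (hab : G.Adj a b) (hbc : G.Adj b c) :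
    ¬ G.Adj a c := by
  intro hac
  have hadj : ∀ i j : Fin 3, G.Adj (![a, b, c] i) (![a, b, c] j) ↔ TriangleGraph.Adj i j := by
    intro i j
    fin_cases i <;> fin_cases j <;>
      simp [TriangleGraph, hab, hbc, hac, hab.symm, hbc.symm, hac.symm]
  refine hC3 ⟨⟨![a, b, c], fun i j hij => by_contra fun hne => ?_⟩, hadj⟩
  exact ((hadj i j).2 hne).ne hij

theorem containsInduced_p2UnionP4_s4 {V : Type*} {G : SimpleGraph V} {u v a b c d : V}
    (huv : G.Adj u v) (hab : G.Adj a b) (hbc : G.Adj b c) (hcd : G.Adj c d)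
    (hac : ¬ G.Adj a c) (hbd : ¬ G.Adj b d) (had : ¬ G.Adj a d)
    (hu : ∀ x ∈ ({a, b, c, d} : Set V), ¬ G.Adj u x)
    (hv : ∀ x ∈ ({a, b, c, d} : Set V), ¬ G.Adj v x) :
    ContainsInduced P2UnionP4 G := by
  simp only [Set.mem_insert_iff, Set.mem_singleton_iff, forall_eq_or_imp, forall_eq] at hu hv
  obtain ⟨hua, hub, huc, hud⟩ := hu
  obtain ⟨hva, hvb, hvc, hvd⟩ := hv
  have hadj : ∀ i j : Fin 6, G.Adj (![u, v, a, b, c, d] i) (![u, v, a, b, c, d] j) ↔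
      P2UnionP4.Adj i j := by
    intro i j
    fin_cases i <;> fin_cases j <;>
      simp [P2UnionP4, huv, hab, hbc, hcd, hac, hbd, had, hua, hub, huc, hud, hva, hvb, hvc, hvd,
        G.adj_comm v u, G.adj_comm b a, G.adj_comm c b, G.adj_comm d c, G.adj_comm c a,
        G.adj_comm d b, G.adj_comm d a, G.adj_comm _ u, G.adj_comm _ v]
  refine ⟨⟨![u, v, a, b, c, d], ?_⟩, hadj⟩
  -- distinct vertices of `P2 ∪ P4` have distinct neighbourhoods
  intro i j hij
  have hnbr : ∀ k, P2UnionP4.Adj i k ↔ P2UnionP4.Adj j k := by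
    intro k
    rw [← hadj, ← hadj, hij]
  have h0 := hnbr 0
  have h1 := hnbr 1
  have h2 := hnbr 2
  have hh3 := hnbr 3
  have h4 := hnbr 4
  have h5 := hnbr 5
  clear hij hnbr
  fin_cases i <;> fin_cases j <;> simp_all [P2UnionP4]

theorem statement_4 {V : Type*} [Fintype V] (G : SimpleGraph V)
    (hP : ¬ ContainsInduced P2UnionP4 G)
    (hC3 : ¬ ContainsInduced TriangleGraph G) :
    G.chromaticNumber ≤ 4 := by
  classical
  have h3 := not_adj_of_not_containsInduced_triangle hC3
  change G.chromaticNumber ≤ ((4 : ℕ) : ℕ∞)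
  rw [chromaticNumber_le_iff_colorable]
  by_cases hE : ∃ u v, G.Adj u v
  swap
  · push Not at hE
    exact ⟨Coloring.mk (fun _ => 0) fun {x y} h => absurd h (hE x y)⟩
  obtain ⟨u, v, huv⟩ := hE
  let M : Set V := {x | ¬ G.Adj u x ∧ ¬ G.Adj v x}
  have hM : (G.induce M).Colorable 2 := by
    refine colorable_two_of_triangleFree_of_pathFour _ (fun a b c => h3 a b c) ?_
    rintro ⟨a, ha⟩ ⟨b, hb⟩ ⟨c, hc⟩ ⟨d, hd⟩ - - hab hbc hcd
    simp only [comap_adj, Function.Embedding.subtype_apply] at hab hbc hcd ⊢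
    by_contra had
    refine hP (containsInduced_p2UnionP4_s4 huv hab hbc hcd (h3 _ _ _ hab hbc) (h3 _ _ _ hbc hcd)
      had ?_ ?_)
    · rintro x (rfl | rfl | rfl | rfl)
      exacts [ha.1, hb.1, hc.1, hd.1]
    · rintro x (rfl | rfl | rfl | rfl)
      exacts [ha.2, hb.2, hc.2, hd.2]
  obtain ⟨C⟩ := hM
  let f : V → Fin 2 ⊕ Fin 2 := fun x =>
    if hx : x ∈ M then Sum.inl (C ⟨x, hx⟩) else if G.Adj u x then Sum.inr 0 else Sum.inr 1
  have hf : ∀ {x y}, G.Adj x y → f x ≠ f y := by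
    intro x y hxy heq
    by_cases hx : x ∈ M <;> by_cases hy : y ∈ M
    · simp only [f, hx, hy, dite_true, Sum.inl.injEq] at heq
      exact C.valid (v := ⟨x, hx⟩) (w := ⟨y, hy⟩) hxy heq
    · simp only [f, hx, hy, dite_true, dite_false] at heq
      split_ifs at heq
    · simp only [f, hx, hy, dite_true, dite_false] at heq
      split_ifs at heq
    · simp only [f, hx, hy, dite_false] at heq
      by_cases hux : G.Adj u x <;> by_cases huy : G.Adj u y
      · exact h3 u x y hux hxy huy
      · simp [hux, huy] at heq
      · simp [hux, huy] at heq
      · have hvx : G.Adj v x := by_contra fun h => hx ⟨hux, h⟩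
        have hvy : G.Adj v y := by_contra fun h => hy ⟨huy, h⟩
        exact h3 v x y hvx hxy hvy
  simpa using (Coloring.mk f hf).colorable
end

section
/- Let G be a connected (P2∪P4, C3)-free simple graph with chromatic number χ(G) = 4. Then G contains the Grötzsch graph F1 as an induced subgraph. -/
open SimpleGraph

namespace CriticalSearch

/-! ### A search over labelled induced subgraphs

The definitions below are evaluated by the kernel, so they are written with recursors and the
primitive operations on natural numbers.  Labelled graphs on at most `16` vertices are stored as one
number `R`, whose bit `16 * i + j` says whether `i` and `j` are adjacent; sets of labels are bit
masks.
-/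

noncomputable section

/-- Application of `k` to `n`, with `n` evaluated first. -/
def force {α : Type} (n : ℕ) (k : ℕ → α) : α := Nat.rec (k 0) (fun p _ => k (Nat.succ p)) n

/-- Fold over the positions of the one bits of `m`, for `m < 2 ^ 16`. -/
def foldBits {α : Type} (f : ℕ → α → α) (m : ℕ) (z : α) : α :=
  Nat.rec (motive := fun _ => ℕ → α) (fun _ => z)
    (fun _ ih m => Nat.rec z (fun m' _ => force (Nat.log2 (Nat.succ m')) fun i =>
      f i (ih (Nat.xor (Nat.succ m') (Nat.pow 2 i)))) m) 16 m

/-- Right fold over a list. -/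
def fold {α β : Type} (f : α → β → β) (l : List α) (z : β) : β :=
  List.rec z (fun a _ ih => f a ih) l

/-- The neighbours of label `i`. -/
def row (R i : ℕ) : ℕ := Nat.land (Nat.shiftRight R (Nat.mul 16 i)) 65535

/-- The mask of the labels below `n`. -/
def full (n : ℕ) : ℕ := Nat.pred (Nat.pow 2 n)

/-- The labels in `m` but not in `N` whose membership in the masks `g` is described by `b`. -/
def matching (b : List Bool) : List ℕ → ℕ → ℕ → ℕ :=
  List.rec (motive := fun _ => List ℕ → ℕ → ℕ → ℕ)
    (fun g m N => List.rec (Nat.xor m (Nat.land m N)) (fun _ _ _ => 0) g)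
    (fun c _ ih g m N => List.rec 0 (fun r rs _ =>
      Bool.rec (ih rs m (Nat.lor N r)) (ih rs (Nat.land m r) N) c) g) b

/-- A configuration: for each vertex its adjacencies to the preceding vertices, the latest one
first, and a lower bound for its degree. -/
abbrev Config := List (List Bool × ℕ)

/-- Whether the configuration `L` embeds into the graph `R`, where `g` lists the rows of the
vertices placed so far, `m` is the set of unused labels and `D d` contains the labels that may have
degree at least `d`. -/
def embeds (R : ℕ) (D : ℕ → ℕ) (L : Config) : List ℕ → ℕ → Bool → Bool :=
  List.rec (motive := fun _ => List ℕ → ℕ → Bool → Bool)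
    (fun _ _ _ => true)
    (fun a _ ih g m z => foldBits (fun i z => ih (row R i :: g) (Nat.xor m (Nat.pow 2 i)) z)
      (matching a.1 g (Nat.land m (D a.2)) 0) z) L

/-- A way to complete two vertices to a copy of `P2UnionP4`.  The first vertex is already placed;
the list describes four further vertices by their adjacencies to the preceding vertices, their
adjacency to the sixth vertex, and whether the vertices after it may be assumed to have smaller
labels. -/
abbrev Placement := List (List Bool × Bool × Bool)

/-- The bit of a trace which records that a vertex is adjacent (or not adjacent) to label `i`. -/
def traceBit (b : Bool) (i : ℕ) : ℕ := Nat.pow 2 (Bool.rec (Nat.add 16 i) i b)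

/-- The traces of a sixth vertex that complete the placement `L`. -/
def completions (R : ℕ) (L : Placement) : List ℕ → ℕ → ℕ → List ℕ → List ℕ :=
  List.rec (motive := fun _ => List ℕ → ℕ → ℕ → List ℕ → List ℕ)
    (fun _ _ q z => force q fun q => q :: z)
    (fun a _ ih g m q z => foldBits (fun i z => ih (row R i :: g)
      (Bool.rec (Nat.xor m (Nat.pow 2 i)) (Nat.land m (full i)) a.2.2)
      (Nat.lor q (traceBit a.2.1 i)) z) (matching a.1 g m 0) z) L

/-- The placements in which the first and the sixth vertex are adjacent. -/
def adjacentPlacements : List Placement :=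
  [[([false], false, false), ([true, false], false, false), ([true, false, false], false, false),
    ([true, false, false, false], false, false)],
   [([false], true, false), ([true, false], false, false), ([false, false, false], false, true),
    ([true, false, false, false], false, false)],
   [([true], false, false), ([true, false], false, false), ([false, false, false], false, true),
    ([true, false, false, false], false, false)],
   [([true], false, false), ([false, false], true, false), ([false, false, false], false, true),
    ([true, false, false, false], false, false)]]

/-- The placements in which the first and the sixth vertex are not adjacent. -/
def nonadjacentPlacements : List Placement :=
  [[([true], false, false), ([false, false], false, false), ([true, false, false], false, false),
    ([true, false, false, false], true, false)],
   [([true], false, false), ([false, false], false, false), ([true, false, false], true, false),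
    ([false, false, false, false], true, false)],
   [([true], false, false), ([true, false], false, false), ([true, false, false], false, false),
    ([false, false, false, false], true, false)],
   [([true], false, false), ([true, false], true, false), ([false, false, false], false, true),
    ([true, false, false, false], false, false)],
   [([true], true, false), ([false, false], true, false), ([false, false, false], false, true),
    ([true, false, false, false], false, false)],
   [([true], false, false), ([false, true], false, false), ([true, false, false], false, false),
    ([false, false, false, false], true, false)],
   [([true], false, false), ([false, true], true, false), ([false, false, false], false, true),
    ([true, false, false, false], false, false)]]

/-- Whether the trace `x` contains a member of `l`. -/
def hits (x : ℕ) (l : List ℕ) : Bool :=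
  List.rec false (fun q _ ih => Bool.rec ih true (Nat.beq (Nat.land x q) q)) l

/-- A graph `R` on the labels below `n`, with a list of the possible traces of a further vertex.
Bit `i` of a trace says that the vertex is adjacent to `i`, bit `16 + i` that it is not. -/
structure State where
  R : ℕ
  n : ℕ
  cands : List ℕ

/-- The column of label `n` when its row is `S`. -/
def column (S n : ℕ) : ℕ :=
  foldBits (fun i z => Nat.lor (Nat.pow 2 (Nat.add (Nat.mul 16 i) n)) z) S 0

/-- The graph `R` with a new vertex `n` whose row is `S`. -/
def extend (R n S : ℕ) : ℕ := Nat.lor R (Nat.lor (Nat.shiftLeft S (Nat.mul 16 n)) (column S n))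

/-- The traces of a vertex that complete the new vertex `n` to a copy of `P2UnionP4`. -/
def forbidden (R n S q : ℕ) (l : List Placement) : List ℕ :=
  fold (fun p z => completions R p [S] (full n) q z) l []

/-- Prepend `x` to `z` unless it contains a member of `P`. -/
def keep (P : List ℕ) (x : ℕ) (z : List ℕ) : List ℕ :=
  force x fun x => Bool.rec (x :: z) z (hits x P)

/-- The traces extending those in `l` to a new vertex with row `S`. -/
def refine (S wi wo : ℕ) (P Q : List ℕ) (l : List ℕ) : List ℕ :=
  fold (fun x z => keep P (Nat.lor x wo)
    (Bool.rec z (keep Q (Nat.lor x wi) z) (Nat.beq (Nat.land x S) 0))) l []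

/-- Add a vertex with trace `x`. -/
def add (s : State) (x : ℕ) : State :=
  force (Nat.land x 65535) fun S => force (extend s.R s.n S) fun R =>
  force (traceBit true s.n) fun wi => force (traceBit false s.n) fun wo =>
  ⟨R, Nat.succ s.n, refine S wi wo (forbidden s.R s.n S wo nonadjacentPlacements)
    (forbidden s.R s.n S wi adjacentPlacements) s.cands⟩

/-- Inclusion of masks. -/
def subset (a b : ℕ) : Bool := Nat.beq (Nat.lor a b) b

/-- The number of elements of a mask. -/
def count (m : ℕ) : ℕ := foldBits (fun _ => Nat.succ) m 0

/-- The trace of being adjacent to `a` and not adjacent to `b`. -/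
def separating (a b : ℕ) : ℕ := Nat.lor (traceBit true a) (traceBit false b)

/-- Branching rules: some vertex must have a trace that contains a member of the rule.  The rules
here come from pairs of vertices with nested neighbourhoods. -/
def vertexRules (s : State) : List (List ℕ) :=
  foldBits (fun x z => (fun r => foldBits (fun y z =>
      Bool.rec z ([separating x y] :: z) (subset r (row s.R y)))
    (Nat.xor (full s.n) (Nat.lor r (Nat.pow 2 x))) z) (row s.R x)) (full s.n) []

/-- The ordered pairs of adjacent labels. -/
def edges (s : State) : List (ℕ × ℕ) :=
  foldBits (fun x z => foldBits (fun y z => (x, y) :: z) (row s.R x) z) (full s.n) []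

/-- Whether the edges `e` and `d` are disjoint and the neighbourhoods of the ends of `e` are
contained in those of the ends of `d`. -/
def nested (R : ℕ) (e d : ℕ × ℕ) : Bool :=
  Bool.rec false (Bool.rec false (subset (row R e.2) (Nat.lor (Nat.pow 2 e.1) (row R d.2)))
      (subset (row R e.1) (Nat.lor (Nat.pow 2 e.2) (row R d.1))))
    (Nat.beq (Nat.land (Nat.lor (Nat.pow 2 e.1) (Nat.pow 2 e.2))
      (Nat.lor (Nat.pow 2 d.1) (Nat.pow 2 d.2))) 0)

/-- The rules from pairs of nested edges. -/
def edgeRules (s : State) : List (List ℕ) :=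
  (fun E => fold (fun e z => fold (fun d z =>
      Bool.rec z ([separating e.1 d.1, separating e.2 d.2] :: z) (nested s.R e d)) E z) E [])
    (edges s)

/-- The rules from vertices of degree less than `k`. -/
def degreeRules (k : ℕ) (s : State) : List (List ℕ) :=
  foldBits (fun x z => Bool.rec z ([traceBit true x] :: z) (Nat.blt (count (row s.R x)) k))
    (full s.n) []

/-- Whether a colouring of the labels below `i` with colour classes `cs` extends to the next `t`
labels. -/
def colours (k R : ℕ) : ℕ → ℕ → List ℕ → Bool
  | 0, _, _ => true
  | t + 1, i, cs => (List.range k).any fun j =>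
      Nat.beq (Nat.land (cs.getD j 0) (row R i)) 0 &&
        colours k R t (i + 1) (cs.modify j (Nat.lor (Nat.pow 2 i)))

/-- The trivial rule, available for `k`-colourable graphs. -/
def colourRules (k : ℕ) (s : State) : List (List ℕ) :=
  Bool.rec [] [[0]] (colours k s.R s.n 0 (List.replicate k 0))

/-- The candidates allowed by a rule. -/
def branches (s : State) (rule : List ℕ) : List ℕ :=
  fold (fun x z => Bool.rec z (x :: z) (hits x rule)) s.cands []

/-- The length of a list. -/
def len (l : List ℕ) : ℕ := fold (fun _ => Nat.succ) l 0

/-- A shortest list among `b` and the members of `l`. -/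
def shortest (l : List (List ℕ)) : List ℕ → List ℕ :=
  List.rec (motive := fun _ => List ℕ → List ℕ) (fun b => b)
    (fun c _ ih b => Bool.rec (ih c) (ih b) (Nat.ble (len b) (len c))) l

/-- A shortest list of branches for a rule in the first nonempty member of `l`. -/
def choose (s : State) (l : List (List (List ℕ))) : Option (List ℕ) :=
  fold (fun Rs z => List.rec z (fun r rs _ =>
    some (shortest (fold (fun a z => branches s a :: z) rs []) (branches s r))) Rs) l none

/-- The labels of degree at least `d`. -/
def highDegree (s : State) (d : ℕ) : ℕ :=
  force (foldBits (fun x z => Bool.rec z (Nat.lor (Nat.pow 2 x) z)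
    (Nat.ble d (count (row s.R x)))) (full s.n) 0) fun x => x

/-- Whether one of the configurations embeds. -/
def rejected (cfgs : List Config) (s : State) : Bool :=
  fold (fun c z => embeds s.R (highDegree s) c [] (full s.n) z) cfgs false

/-- Whether the search of depth `t` from the state `s` closes all branches. -/
def dead (k : ℕ) (cfgs : List Config) (t : ℕ) : State → Bool :=
  Nat.rec (fun _ => false) (fun _ ih s =>
    Bool.rec (Option.rec false (fun c => fold (fun x z => Bool.rec false z (ih (add s x))) c true)
      (choose s [vertexRules s, edgeRules s, degreeRules k s, colourRules k s])) true
      (rejected cfgs s)) t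

/-- The state of the graph in which label `i` has the lower neighbours `L[i]`. -/
def build (L : List ℕ) : State := L.foldl add ⟨0, 0, [0]⟩

end

/-! ### Bit masks -/

theorem force_eq {α : Type} (n : ℕ) (k : ℕ → α) : force n k = k n := by
  cases n <;> rfl

theorem fold_eq {α β : Type} (f : α → β → β) (l : List α) (z : β) :
    fold f l z = l.foldr f z := by
  induction l with
  | nil => rfl
  | cons a l ih => exact congrArg (f a) ih

theorem testBit_xor_log {m i : ℕ} (hm : m ≠ 0) :
    (m ^^^ 2 ^ m.log2).testBit i = (m.testBit i && decide (i ≠ m.log2)) := by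
  have h : m.testBit m.log2 = true := Nat.testBit_log2 hm
  rw [Nat.testBit_xor, Nat.testBit_two_pow]
  by_cases hi : m.log2 = i
  · subst hi; simp [h]
  · simp [hi, Ne.symm hi]

theorem xor_log_lt {m t : ℕ} (hm : m ≠ 0) (ht : m < 2 ^ (t + 1)) :
    m ^^^ 2 ^ m.log2 < 2 ^ t := by
  refine Nat.lt_pow_two_of_testBit _ fun i hi => ?_
  rw [testBit_xor_log hm]
  by_cases hi' : i = m.log2
  · simp [hi']
  · have : m.log2 < t + 1 := (Nat.log2_lt hm).2 ht
    have : m < 2 ^ i := (Nat.log2_lt hm).1 (by omega)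
    simp [Nat.testBit_lt_two_pow this]

theorem foldBits_aux {α : Type} (f : ℕ → α → α) (z : α) (t : ℕ) :
    ∃ e : ℕ → List ℕ, (∀ m, (Nat.rec (motive := fun _ => ℕ → α) (fun _ => z)
      (fun _ ih m => Nat.rec z (fun m' _ => force (Nat.log2 (Nat.succ m')) fun i =>
        f i (ih (Nat.xor (Nat.succ m') (Nat.pow 2 i)))) m) t m) = (e m).foldr f z) ∧
      (∀ m i, i ∈ e m → m.testBit i) ∧ (∀ m i, m < 2 ^ t → m.testBit i → i ∈ e m) := by
  induction t with
  | zero =>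
    refine ⟨fun _ => [], fun m => rfl, by simp, fun m i hm hi => ?_⟩
    obtain rfl : m = 0 := by omega
    simp at hi
  | succ t ih =>
    obtain ⟨e, h1, h2, h3⟩ := ih
    refine ⟨fun m => if m = 0 then [] else m.log2 :: e (m ^^^ 2 ^ m.log2), fun m => ?_,
      fun m i hi => ?_, fun m i hm hi => ?_⟩
    · cases m with
      | zero => rfl
      | succ m =>
        beta_reduce
        rw [if_neg (Nat.succ_ne_zero m), List.foldr_cons]
        exact (force_eq _ _).trans (congrArg _ (h1 _))
    · by_cases hm : m = 0
      · simp [hm] at hi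
      · simp only [hm, if_false, List.mem_cons] at hi
        rcases hi with rfl | hi
        · exact Nat.testBit_log2 hm
        · have := h2 _ _ hi
          rw [testBit_xor_log hm] at this
          simp_all
    · have hm0 : m ≠ 0 := by rintro rfl; simp at hi
      simp only [hm0, if_false, List.mem_cons]
      by_cases h : i = m.log2
      · exact Or.inl h
      · exact Or.inr (h3 _ _ (xor_log_lt hm0 hm) (by rw [testBit_xor_log hm0]; simp [hi, h]))

theorem foldBits_eq {α : Type} (f : ℕ → α → α) (m : ℕ) (z : α) :
    ∃ l : List ℕ, foldBits f m z = l.foldr f z ∧ (∀ i ∈ l, m.testBit i) ∧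
      (m < 65536 → ∀ i, m.testBit i → i ∈ l) := by
  obtain ⟨e, h1, h2, h3⟩ := foldBits_aux f z 16
  exact ⟨e m, h1 m, h2 m, fun hm i => h3 m i hm⟩

theorem foldBits_induction {α : Type} {f : ℕ → α → α} {m : ℕ} {z : α} (P : α → Prop) (h0 : P z)
    (hs : ∀ i a, m.testBit i → P a → P (f i a)) : P (foldBits f m z) := by
  obtain ⟨l, h, hl, -⟩ := foldBits_eq f m z
  rw [h]
  clear h
  induction l with
  | nil => exact h0
  | cons a l ih => exact hs _ _ (hl _ (by simp)) (ih fun i hi => hl i (by simp [hi]))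

theorem fold_induction {α β : Type} {f : α → β → β} {l : List α} {z : β} (P : β → Prop) (h0 : P z)
    (hs : ∀ a b, a ∈ l → P b → P (f a b)) : P (fold f l z) := by
  rw [fold_eq]
  induction l with
  | nil => exact h0
  | cons a l ih => exact hs _ _ (by simp) (ih fun i b hi => hs i b (by simp [hi]))

theorem testBit_full {n i : ℕ} : (full n).testBit i = decide (i < n) :=
  Nat.testBit_two_pow_sub_one n i

theorem testBit_row {R i j : ℕ} :
    (row R i).testBit j = (R.testBit (16 * i + j) && decide (j < 16)) := by
  have : row R i = (R >>> (16 * i)) &&& (2 ^ 16 - 1) := rfl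
  rw [this, Nat.testBit_and, Nat.testBit_shiftRight, Nat.testBit_two_pow_sub_one]

theorem testBit_land_low {x i : ℕ} :
    (Nat.land x 65535).testBit i = (x.testBit i && decide (i < 16)) := by
  have : Nat.land x 65535 = x &&& (2 ^ 16 - 1) := rfl
  rw [this, Nat.testBit_and, Nat.testBit_two_pow_sub_one]

theorem subset_eq_true {a b : ℕ} (h : subset a b = true) {i : ℕ} (hi : a.testBit i) :
    b.testBit i := by
  have : a ||| b = b := Nat.eq_of_beq_eq_true h
  rw [← this, Nat.testBit_or, hi, Bool.true_or]

theorem hits_eq_true {x : ℕ} {l : List ℕ} :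
    hits x l = true ↔ ∃ q ∈ l, ∀ i, q.testBit i → x.testBit i := by
  induction l with
  | nil => simp [hits]
  | cons q l ih =>
    have h : hits x (q :: l) = (Nat.beq (x &&& q) q || hits x l) := by
      change Bool.rec (motive := fun _ => Bool) (hits x l) true (Nat.beq (x &&& q) q) = _
      cases Nat.beq (x &&& q) q <;> rfl
    have h2 : Nat.beq (x &&& q) q = true ↔ ∀ i, q.testBit i → x.testBit i := by
      rw [Nat.beq_eq]
      constructor
      · intro e i hi
        rw [← e, Nat.testBit_and] at hi
        simp_all
      · intro e
        refine Nat.eq_of_testBit_eq fun i => ?_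
        rw [Nat.testBit_and]
        cases hq : q.testBit i
        · simp
        · simp [e i hq]
    rw [h, Bool.or_eq_true, ih, h2]
    simp

theorem testBit_traceBit_true {i j : ℕ} : (traceBit true i).testBit j = decide (i = j) :=
  Nat.testBit_two_pow

theorem testBit_traceBit_false {i j : ℕ} : (traceBit false i).testBit j = decide (16 + i = j) :=
  Nat.testBit_two_pow

theorem testBit_xor_pow {m i j : ℕ} (hi : m.testBit i) :
    (Nat.xor m (Nat.pow 2 i)).testBit j = (m.testBit j && decide (j ≠ i)) := by
  change (m ^^^ 2 ^ i).testBit j = _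
  rw [Nat.testBit_xor, Nat.testBit_two_pow]
  by_cases h : i = j
  · subst h; simp [hi]
  · simp [h, Ne.symm h]

theorem testBit_matching {b : List Bool} {g : List ℕ} {m N i : ℕ}
    (h : (matching b g m N).testBit i = true) :
    m.testBit i = true ∧ N.testBit i = false ∧ List.Forall₂ (fun c r => r.testBit i = c) b g := by
  induction b generalizing g m N with
  | nil =>
    cases g with
    | nil =>
      change (m ^^^ (m &&& N)).testBit i = true at h
      rw [Nat.testBit_xor, Nat.testBit_and] at h
      refine ⟨?_, ?_, List.Forall₂.nil⟩ <;> revert h <;> cases m.testBit i <;>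
        cases N.testBit i <;> simp
    | cons r g =>
      change (0 : ℕ).testBit i = true at h
      simp at h
  | cons c b ih =>
    cases g with
    | nil =>
      change (0 : ℕ).testBit i = true at h
      simp at h
    | cons r g =>
      cases c with
      | false =>
        obtain ⟨h1, h2, h3⟩ := ih (m := m) (N := N ||| r) h
        rw [Nat.testBit_or, Bool.or_eq_false_iff] at h2
        exact ⟨h1, h2.1, .cons h2.2 h3⟩
      | true =>
        obtain ⟨h1, h2, h3⟩ := ih (m := m &&& r) (N := N) h
        rw [Nat.testBit_and, Bool.and_eq_true] at h1
        exact ⟨h1.1, h2, .cons h1.2 h3⟩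

theorem exists_elements_of_count_lt {m k : ℕ} (hm : m < 65536) (h : Nat.blt (count m) k = true) :
    ∃ l : List ℕ, l.length < k ∧ ∀ i, m.testBit i → i ∈ l := by
  obtain ⟨l, h1, -, h2⟩ := foldBits_eq (fun _ => Nat.succ) m 0
  refine ⟨l, ?_, h2 hm⟩
  have : count m = l.length := by
    rw [count, h1]
    clear h1 h2
    induction l with
    | nil => rfl
    | cons a l ih => simp [ih]
  rw [← this]
  simpa [Nat.blt_eq] using h

theorem testBit_column {S n p : ℕ} (hS : S < 65536) (hn : n < 16) :
    (column S n).testBit p = true ↔ p % 16 = n ∧ S.testBit (p / 16) = true := by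
  obtain ⟨l, h, h1, h2⟩ :=
    foldBits_eq (fun i z => Nat.lor (Nat.pow 2 (Nat.add (Nat.mul 16 i) n)) z) S 0
  have key : (column S n).testBit p = true ↔ ∃ i ∈ l, 16 * i + n = p := by
    rw [column, h]
    clear h h1 h2
    induction l with
    | nil => simp
    | cons a l ih =>
      rw [List.foldr_cons]
      change (2 ^ (16 * a + n) ||| _).testBit p = true ↔ _
      rw [Nat.testBit_or, Nat.testBit_two_pow, Bool.or_eq_true, ih]
      simp
  rw [key]
  constructor
  · rintro ⟨i, hi, rfl⟩
    have := h1 i hi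
    have e : (16 * i + n) / 16 = i := by omega
    rw [e]
    exact ⟨by omega, this⟩
  · rintro ⟨h3, h4⟩
    exact ⟨p / 16, h2 hS _ h4, by omega⟩

theorem testBit_extend {R n S p : ℕ} (hS : S < 65536) (hn : n < 16) :
    (extend R n S).testBit p = true ↔
      R.testBit p = true ∨ (16 * n ≤ p ∧ S.testBit (p - 16 * n) = true) ∨
      (p % 16 = n ∧ S.testBit (p / 16) = true) := by
  change (R ||| (S <<< (16 * n) ||| column S n)).testBit p = true ↔ _
  rw [Nat.testBit_or, Nat.testBit_or, Nat.testBit_shiftLeft, Bool.or_eq_true, Bool.or_eq_true,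
    testBit_column hS hn, Bool.and_eq_true, decide_eq_true_iff]

/-! ### Critical sets of vertices -/

variable {V : Type*} {G : SimpleGraph V} {W : Set V}

/-- `W` induces a `k`-colourable subgraph of `G`. -/
def ColorableOn (G : SimpleGraph V) (W : Set V) (k : ℕ) : Prop :=
  ∃ c : V → ℕ, (∀ v ∈ W, c v < k) ∧ ∀ u ∈ W, ∀ v ∈ W, G.Adj u v → c u ≠ c v

/-- `W` is minimal among the sets inducing a subgraph that is not `k`-colourable. -/
def Critical (G : SimpleGraph V) (k : ℕ) (W : Set V) : Prop :=
  ¬ ColorableOn G W k ∧ ∀ v ∈ W, ColorableOn G (W \ {v}) k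

theorem exists_critical_of_not_colorableOn [Finite V] {k : ℕ} {U : Set V}
    (hU : ¬ ColorableOn G U k) :
    ∃ W ⊆ U, Critical G k W := by
  obtain ⟨W, hWU, hW⟩ := (Set.toFinite {W : Set V | ¬ ColorableOn G W k}).exists_le_minimal hU
  refine ⟨W, hWU, hW.prop, fun v hv => ?_⟩
  by_contra h
  exact (hW.le_of_le h Set.sdiff_subset hv).2 rfl

namespace Critical

variable {k : ℕ}

/-- In a critical graph, a colouring of all vertices but `x` cannot be extended to `x`. -/
theorem exists_adj_of_color (h : Critical G k W) {x : V} (hx : x ∈ W) {c : V → ℕ}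
    (hc : ∀ v ∈ W, v ≠ x → c v < k)
    (hc' : ∀ u ∈ W, ∀ v ∈ W, u ≠ x → v ≠ x → G.Adj u v → c u ≠ c v) {j : ℕ} (hj : j < k) :
    ∃ w ∈ W, G.Adj w x ∧ c w = j := by
  by_contra! hw
  refine h.1 ⟨fun v => open Classical in if v = x then j else c v, fun v hv => ?_,
    fun u hu v hv huv => ?_⟩
  · by_cases hvx : v = x
    · simp [hvx, hj]
    · simp [hvx, hc v hv hvx]
  · by_cases hux : u = x
    · subst hux
      have hvu : v ≠ u := huv.ne'
      simpa [hvu] using (hw v hv huv.symm).symm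
    · by_cases hvx : v = x
      · subst hvx
        simpa [hux] using hw u hu huv
      · simpa [hux, hvx] using hc' u hu v hv hux hvx huv

theorem exists_coloring (h : Critical G k W) {x : V} (hx : x ∈ W) :
    ∃ c : V → ℕ, (∀ v ∈ W, v ≠ x → c v < k) ∧
      ∀ u ∈ W, ∀ v ∈ W, u ≠ x → v ≠ x → G.Adj u v → c u ≠ c v := by
  obtain ⟨c, h1, h2⟩ := h.2 x hx
  exact ⟨c, fun v hv hvx => h1 v ⟨hv, hvx⟩, fun u hu v hv hux hvx =>
    h2 u ⟨hu, hux⟩ v ⟨hv, hvx⟩⟩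

theorem exists_adj_not_adj (h : Critical G k W) {x y : V} (hx : x ∈ W) (hy : y ∈ W) (hxy : x ≠ y) :
    ∃ w ∈ W, G.Adj w x ∧ ¬ G.Adj w y := by
  obtain ⟨c, hc, hc'⟩ := h.exists_coloring hx
  obtain ⟨w, hw, hwx, hcw⟩ := h.exists_adj_of_color hx hc hc' (hc y hy hxy.symm)
  exact ⟨w, hw, hwx, fun hwy => hc' w hw y hy hwx.ne hxy.symm hwy hcw⟩

theorem exists_adj_not_adj_of_edges (h : Critical G k W) {x y p q : V} (hx : x ∈ W) (hy : y ∈ W)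
    (hp : p ∈ W) (hq : q ∈ W) (hpx : p ≠ x) (hpy : p ≠ y) (hqx : q ≠ x) (hqy : q ≠ y)
    (hxy : G.Adj x y) (hpq : G.Adj p q) :
    ∃ w ∈ W, (G.Adj w x ∧ w ≠ y ∧ ¬ G.Adj w p) ∨ (G.Adj w y ∧ w ≠ x ∧ ¬ G.Adj w q) := by
  classical
  obtain ⟨c, hc, hc'⟩ := h.exists_coloring hx
  by_contra! hw
  have hd : ∀ u ∈ W, ∀ v ∈ W, u ≠ x → v ≠ x → G.Adj u v →
      Function.update c y (c q) u ≠ Function.update c y (c q) v := by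
    intro u hu v hv hux hvx huv
    by_cases huy : u = y
    · subst huy
      rw [Function.update_self, Function.update_of_ne huv.ne']
      exact hc' q hq v hv hqx hvx ((hw v hv).2 huv.symm hvx).symm
    · by_cases hvy : v = y
      · subst hvy
        rw [Function.update_self, Function.update_of_ne huv.ne]
        exact hc' u hu q hq hux hqx ((hw u hu).2 huv hux)
      · rw [Function.update_of_ne huy, Function.update_of_ne hvy]
        exact hc' u hu v hv hux hvx huv
  obtain ⟨w, hwW, hwx, hcw⟩ := h.exists_adj_of_color hx (c := Function.update c y (c q)) (j := c p)
    (fun v hv hvx => by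
      by_cases hvy : v = y
      · subst hvy; simpa using hc q hq hqx
      · simpa [hvy] using hc v hv hvx) hd (hc p hp hpx)
  by_cases hwy : w = y
  · subst hwy
    rw [Function.update_self] at hcw
    exact hc' p hp q hq hpx hqx hpq hcw.symm
  · rw [Function.update_of_ne hwy] at hcw
    exact hc' w hwW p hp hwx.ne hpx ((hw w hwW).1 hwx hwy) hcw

theorem exists_adj_notMem (h : Critical G k W) {x : V} (hx : x ∈ W) {l : List V}
    (hl : l.length < k) : ∃ w ∈ W, G.Adj w x ∧ w ∉ l := by
  obtain ⟨c, hc, hc'⟩ := h.exists_coloring hx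
  obtain ⟨j, hj, hjl⟩ : ∃ j < k, j ∉ l.map c := by
    by_contra! hcon
    have := Finset.card_le_card (s := Finset.range k) (t := (l.map c).toFinset)
      fun j hj => by simpa using hcon j (by simpa using hj)
    have h2 := List.toFinset_card_le (l.map c)
    simp at this h2
    omega
  obtain ⟨w, hw, hwx, hcw⟩ := h.exists_adj_of_color hx hc hc' hj
  exact ⟨w, hw, hwx, fun hwl => hjl (hcw ▸ List.mem_map_of_mem hwl)⟩

end Critical

/-! ### Copies of labelled graphs -/

/-- The subgraph induced by `W` contains the graph on the labels below `k` with adjacency `A`. -/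
def Copy (G : SimpleGraph V) (W : Set V) (k : ℕ) (A : ℕ → ℕ → Bool) : Prop :=
  ∃ g : ℕ → V, (∀ i < k, g i ∈ W) ∧ (∀ i < k, ∀ j < k, g i = g j → i = j) ∧
    ∀ i < k, ∀ j < k, (A i j = true ↔ G.Adj (g i) (g j))

theorem Copy.relabel {k : ℕ} {A : ℕ → ℕ → Bool} (h : Copy G W k A) (l : List ℕ) {k' : ℕ}
    {A' : ℕ → ℕ → Bool} (hl : ∀ i < k', l.getD i 0 < k)
    (hinj : ∀ i < k', ∀ j < k', l.getD i 0 = l.getD j 0 → i = j)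
    (hA : ∀ i < k', ∀ j < k', A' i j = A (l.getD i 0) (l.getD j 0)) : Copy G W k' A' := by
  obtain ⟨g, h1, h2, h3⟩ := h
  refine ⟨fun i => g (l.getD i 0), fun i hi => h1 _ (hl i hi), fun i hi j hj hij => ?_,
    fun i hi j hj => ?_⟩
  · exact hinj i hi j hj (h2 _ (hl i hi) _ (hl j hj) hij)
  · rw [hA i hi j hj]
    exact h3 _ (hl i hi) _ (hl j hj)

theorem Copy.containsInduced {k : ℕ} {A : ℕ → ℕ → Bool} (h : Copy G W k A) {H : SimpleGraph (Fin k)}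
    (hH : ∀ i j : Fin k, H.Adj i j ↔ A i j = true) : ContainsInduced H G := by
  obtain ⟨g, -, h2, h3⟩ := h
  refine ⟨⟨fun i => g i, fun i j hij => Fin.ext (h2 _ i.2 _ j.2 hij)⟩, fun i j => ?_⟩
  rw [hH]
  exact (h3 _ i.2 _ j.2).symm

/-- The distinct vertices `us`, the latest one first, have the adjacencies `L`. -/
def Fits (G : SimpleGraph V) (W : Set V) : List (List Bool) → List V → Prop
  | [], [] => True
  | b :: L, u :: us => u ∈ W ∧ u ∉ us ∧ List.Forall₂ (fun c v => c = true ↔ G.Adj u v) b us ∧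
      Fits G W L us
  | _, _ => False

/-- The adjacency relation described by a list of the adjacencies of each label to the preceding
labels, the latest one first. -/
def adjOf (L : List (List Bool)) (i j : ℕ) : Bool :=
  bif j < i then (L.getD i []).getD (i - 1 - j) false
  else bif i < j then (L.getD j []).getD (j - 1 - i) false else false

theorem fits_iff {L : List (List Bool)} {us : List V} (h : Fits G W L us) :
    us.length = L.length ∧ us.Nodup ∧ (∀ u ∈ us, u ∈ W) ∧
      ∀ i j : ℕ, ∀ (hi : i < us.length) (hj : j < us.length), i < j →
        ((L.getD i []).getD (j - 1 - i) false = true ↔ G.Adj us[i] us[j]) := by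
  induction L generalizing us with
  | nil =>
    cases us with
    | nil => simp
    | cons u us => exact h.elim
  | cons b L ih =>
    cases us with
    | nil => exact h.elim
    | cons u us =>
      obtain ⟨h1, h2, h3, h4⟩ := h
      obtain ⟨i1, i2, i3, i4⟩ := ih h4
      refine ⟨by simp [i1], by simp [h2, i2], ?_, ?_⟩
      · simpa using ⟨h1, i3⟩
      · intro i j hi hj hij
        obtain ⟨j, rfl⟩ : ∃ j', j = j' + 1 := ⟨j - 1, by omega⟩
        simp only [List.length_cons] at hi hj
        cases i with
        | zero =>
          have hb := h3.length_eq
          have := (List.forall₂_iff_get.1 h3).2 j (by omega) (by omega)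
          simpa [List.getD_eq_getElem?_getD, hb, show j < us.length by omega] using this
        | succ i =>
          have := i4 i j (by omega) (by omega) (by omega)
          rw [show j + 1 - 1 - (i + 1) = j - 1 - i by omega]
          simpa using this

theorem Fits.copy {L : List (List Bool)} {us : List V} (h : Fits G W L.reverse us) (hL : L ≠ []) :
    Copy G W L.length (adjOf L) := by
  obtain ⟨h1, h2, h3, h4⟩ := fits_iff h
  rw [List.length_reverse] at h1
  have h0 : 0 < L.length := List.length_pos_iff.2 hL
  have key : ∀ i j : ℕ, ∀ (hi : i < L.length) (hj : j < L.length), i < j →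
      ((L.getD j []).getD (j - 1 - i) false = true ↔
        G.Adj (us[L.length - 1 - j]'(by omega)) (us[L.length - 1 - i]'(by omega))) := by
    intro i j hi hj hij
    rw [← h4 _ _ _ _ (by omega), List.getD_eq_getElem?_getD (l := L.reverse),
      List.getElem?_reverse (by omega), ← List.getD_eq_getElem?_getD,
      show L.length - 1 - (L.length - 1 - j) = j by omega,
      show L.length - 1 - i - 1 - (L.length - 1 - j) = j - 1 - i by omega]
  refine ⟨fun i => if hi : i < L.length then us[L.length - 1 - i]'(by omega) else
    us[0]'(by omega), ?_, ?_, ?_⟩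
  · intro i hi
    simpa [hi] using h3 _ (List.getElem_mem _)
  · intro i hi j hj hij
    simp only [hi, hj, dif_pos] at hij
    have := (h2.getElem_inj_iff).1 hij
    omega
  · intro i hi j hj
    simp only [hi, hj, dif_pos, adjOf]
    rcases lt_trichotomy i j with hij | rfl | hij
    · simp only [hij, decide_true, cond_true, hij.not_gt, decide_false, cond_false]
      rw [key i j hi hj hij, G.adj_comm]
    · simp
    · simp only [hij, decide_true, cond_true]
      exact key j i hj hi hij

/-- The adjacencies of a placement whose first and sixth vertex are adjacent or not, as told by
`b`. -/
def placementGraph (b : Bool) (p : Placement) : List (List Bool) :=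
  [] :: (p.map (·.1) ++ [(b :: p.map (·.2.1)).reverse])

theorem containsInduced_P2UnionP4 {b : Bool} {p : Placement} {us : List V}
    (hp : p ∈ cond b adjacentPlacements nonadjacentPlacements)
    (h : Fits G W (placementGraph b p).reverse us) : ContainsInduced P2UnionP4 G := by
  have key : ∃ l : List ℕ, (placementGraph b p).length = 6 ∧ (∀ i < 6, l.getD i 0 < 6) ∧
      (∀ i < 6, ∀ j < 6, l.getD i 0 = l.getD j 0 → i = j) ∧
      ∀ i < 6, ∀ j < 6, adjOf [[], [true], [false, false], [true, false, false],
        [true, false, false, false], [true, false, false, false, false]] i j =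
          adjOf (placementGraph b p) (l.getD i 0) (l.getD j 0) := by
    cases b
    · simp only [cond_false, adjacentPlacements, nonadjacentPlacements, List.mem_cons,
        List.not_mem_nil, or_false] at hp
      rcases hp with rfl | rfl | rfl | rfl | rfl | rfl | rfl
      · exact ⟨[0, 1, 2, 3, 4, 5], by decide +kernel⟩
      · exact ⟨[0, 1, 2, 3, 5, 4], by decide +kernel⟩
      · exact ⟨[4, 5, 0, 1, 2, 3], by decide +kernel⟩
      · exact ⟨[3, 4, 0, 1, 2, 5], by decide +kernel⟩
      · exact ⟨[3, 4, 0, 1, 5, 2], by decide +kernel⟩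
      · exact ⟨[4, 5, 1, 0, 2, 3], by decide +kernel⟩
      · exact ⟨[3, 4, 1, 0, 2, 5], by decide +kernel⟩
    · simp only [cond_true, adjacentPlacements, nonadjacentPlacements, List.mem_cons,
        List.not_mem_nil, or_false] at hp
      rcases hp with rfl | rfl | rfl | rfl
      · exact ⟨[0, 5, 1, 2, 3, 4], by decide +kernel⟩
      · exact ⟨[3, 4, 0, 5, 1, 2], by decide +kernel⟩
      · exact ⟨[3, 4, 2, 1, 0, 5], by decide +kernel⟩
      · exact ⟨[3, 4, 1, 0, 5, 2], by decide +kernel⟩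
  obtain ⟨l, h6, h1, h2, h3⟩ := key
  have hc := h.copy (by simp [placementGraph])
  rw [h6] at hc
  refine (hc.relabel l h1 h2 h3).containsInduced ?_
  simp only [P2UnionP4, SimpleGraph.fromEdgeSet_adj, Set.mem_insert_iff, Set.mem_singleton_iff]
  decide

/-! ### Soundness of the search -/

/-- `x` is the trace of `w` on the first `n` vertices of `f`. -/
def IsTrace (G : SimpleGraph V) (f : ℕ → V) (n : ℕ) (w : V) (x : ℕ) : Prop :=
  ∀ p, x.testBit p = true ↔
    (p < n ∧ G.Adj w (f p)) ∨ (16 ≤ p ∧ p < 16 + n ∧ ¬ G.Adj w (f (p - 16)))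

/-- The labelling `f` of vertices in `W` realizes the state `s`. -/
structure Realizes (G : SimpleGraph V) (W : Set V) (s : State) (f : ℕ → V) : Prop where
  le : s.n ≤ 16
  mem : ∀ i < s.n, f i ∈ W
  inj : ∀ i < s.n, ∀ j < s.n, f i = f j → i = j
  adj : ∀ p, s.R.testBit p = true ↔
    p / 16 < s.n ∧ p % 16 < s.n ∧ G.Adj (f (p / 16)) (f (p % 16))
  cands : ∀ w ∈ W, (∀ i < s.n, f i ≠ w) → ∃ x ∈ s.cands, IsTrace G f s.n w x

namespace Realizes

variable {s : State} {f : ℕ → V}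

theorem congr (h : Realizes G W s f) {f' : ℕ → V} (hf : ∀ i < s.n, f' i = f i) :
    Realizes G W s f' := by
  refine ⟨h.le, fun i hi => hf i hi ▸ h.mem i hi, fun i hi j hj hij => ?_, fun p => ?_,
    fun w hw hwf => ?_⟩
  · rw [hf i hi, hf j hj] at hij
    exact h.inj i hi j hj hij
  · rw [h.adj]
    refine and_congr_right fun h1 => and_congr_right fun h2 => ?_
    rw [hf _ h1, hf _ h2]
  · obtain ⟨x, hx, hx'⟩ := h.cands w hw fun i hi => hf i hi ▸ hwf i hi
    refine ⟨x, hx, fun p => (hx' p).trans (or_congr ?_ ?_)⟩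
    · exact and_congr_right fun h1 => by rw [hf _ h1]
    · exact and_congr_right fun h1 => and_congr_right fun h2 => by rw [hf _ (by omega)]

theorem testBit_row (h : Realizes G W s f) {i j : ℕ} :
    (row s.R i).testBit j = true ↔ i < s.n ∧ j < s.n ∧ G.Adj (f i) (f j) := by
  rw [CriticalSearch.testBit_row, Bool.and_eq_true, h.adj, decide_eq_true_iff]
  constructor
  · rintro ⟨h1, hj⟩
    rwa [show (16 * i + j) / 16 = i by omega, show (16 * i + j) % 16 = j by omega] at h1
  · intro h1
    have hj : j < 16 := h1.2.1.trans_le h.le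
    rw [show (16 * i + j) / 16 = i by omega, show (16 * i + j) % 16 = j by omega]
    exact ⟨h1, hj⟩

/-- The rows `g` describe the adjacencies of `us` to the labelled vertices. -/
def Rows (G : SimpleGraph V) (f : ℕ → V) (n : ℕ) (g : List ℕ) (us : List V) : Prop :=
  List.Forall₂ (fun r u => ∀ i < n, (r.testBit i = true ↔ G.Adj u (f i))) g us

theorem rows_cons (h : Realizes G W s f) {g : List ℕ} {us : List V} (hg : Rows G f s.n g us)
    {i : ℕ} (hi : i < s.n) : Rows G f s.n (row s.R i :: g) (f i :: us) :=
  .cons (fun j hj => by rw [h.testBit_row]; simp [hi, hj]) hg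

theorem forall₂_of_rows {n : ℕ} {b : List Bool} {g : List ℕ} {us : List V} {i : ℕ} (hi : i < n)
    (hb : List.Forall₂ (fun c r => r.testBit i = c) b g) (hg : Rows G f n g us) :
    List.Forall₂ (fun c v => c = true ↔ G.Adj (f i) v) b us := by
  induction hb generalizing us with
  | nil => cases hg; exact .nil
  | cons h1 _ ih =>
    cases hg with
    | cons h2 h3 => exact .cons (by rw [← h1, h2 i hi, G.adj_comm]) (ih h3)

theorem fits_of_embeds (h : Realizes G W s f) {D : ℕ → ℕ} {L : Config} {g : List ℕ} {m : ℕ}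
    {us : List V} {L₀ : List (List Bool)} (hfit : Fits G W L₀ us) (hg : Rows G f s.n g us)
    (hm : ∀ i, m.testBit i → i < s.n ∧ f i ∉ us) (he : embeds s.R D L g m false = true) :
    ∃ us', Fits G W ((L.map (·.1)).reverse ++ L₀) us' := by
  induction L generalizing g m us L₀ with
  | nil => exact ⟨us, by simpa using hfit⟩
  | cons a L ih =>
    refine foldBits_induction (P := fun z => z = true → _) (by simp) (fun i z hi hz => ?_) he
    obtain ⟨h1, -, h2⟩ := testBit_matching hi
    have hmi := hm i (by
      change (m &&& _).testBit i = true at h1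
      rw [Nat.testBit_and, Bool.and_eq_true] at h1
      exact h1.1)
    intro he'
    cases z with
    | true => exact hz rfl
    | false =>
      obtain ⟨us', hus'⟩ := ih (us := f i :: us) (L₀ := a.1 :: L₀)
        ⟨h.mem i hmi.1, hmi.2, forall₂_of_rows hmi.1 h2 hg, hfit⟩ (h.rows_cons hg hmi.1)
        (fun j hj => by
          rw [testBit_xor_pow (by
            change (m &&& _).testBit i = true at h1
            rw [Nat.testBit_and, Bool.and_eq_true] at h1
            exact h1.1), Bool.and_eq_true, decide_eq_true_iff] at hj
          refine ⟨(hm j hj.1).1, ?_⟩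
          rw [List.mem_cons, not_or]
          exact ⟨fun e => hj.2 (h.inj j (hm j hj.1).1 i hmi.1 e), (hm j hj.1).2⟩) he'
      exact ⟨us', by simpa using hus'⟩

theorem copy_of_rejected (h : Realizes G W s f) {cfgs : List Config} (hc : ∀ c ∈ cfgs, c ≠ [])
    (he : rejected cfgs s = true) : ∃ c ∈ cfgs, Copy G W c.length (adjOf (c.map (·.1))) := by
  refine fold_induction (P := fun z => z = true → _) (by simp) (fun c z hcm hz => ?_) he
  cases z with
  | true => exact fun _ => hz rfl
  | false =>
    intro he
    obtain ⟨us, hus⟩ :=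
      h.fits_of_embeds (us := []) (L₀ := []) trivial .nil (by simp [testBit_full]) he
    rw [List.append_nil] at hus
    exact ⟨c, hcm, by simpa using hus.copy (by simpa using hc c hcm)⟩

theorem fits_of_completions (h : Realizes G W s f) {w : V} {y : ℕ}
    (hy : ∀ b, ∀ i < s.n, (∀ j, (traceBit b i).testBit j → y.testBit j) →
      (b = true ↔ G.Adj w (f i)))
    (hw : ∀ i < s.n, f i ≠ w) {L : Placement} {g : List ℕ} {m q₀ : ℕ} {z : List ℕ} {us : List V}
    {L₀ : List (List Bool)} {bs : List Bool} (hfit : Fits G W L₀ us) (hg : Rows G f s.n g us)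
    (hm : ∀ i, m.testBit i → i < s.n ∧ f i ∉ us) (hwus : w ∉ us)
    (hbs : (∀ j, q₀.testBit j → y.testBit j) →
      List.Forall₂ (fun c v => c = true ↔ G.Adj w v) bs us)
    {q : ℕ} (hq : q ∈ completions s.R L g m q₀ z) (hqy : ∀ j, q.testBit j → y.testBit j) :
    q ∈ z ∨ ∃ us', Fits G W ((L.map (·.1)).reverse ++ L₀) us' ∧ w ∉ us' ∧
      List.Forall₂ (fun c v => c = true ↔ G.Adj w v) ((L.map (·.2.1)).reverse ++ bs) us' := by
  induction L generalizing g m us L₀ bs q₀ z with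
  | nil =>
    change q ∈ force q₀ (fun q => q :: z) at hq
    rw [force_eq, List.mem_cons] at hq
    rcases hq with rfl | hq
    · exact .inr ⟨us, by simpa using hfit, hwus, by simpa using hbs hqy⟩
    · exact .inl hq
  | cons a L ih =>
    refine foldBits_induction (P := fun z' : List ℕ => q ∈ z' → q ∈ z ∨ _) .inl
      (fun i z' hi hz => ?_) hq
    obtain ⟨h1, -, h2⟩ := testBit_matching hi
    have hmi := hm i h1
    intro hq'
    have := ih (us := f i :: us) (L₀ := a.1 :: L₀) (bs := a.2.1 :: bs)
      ⟨h.mem i hmi.1, hmi.2, forall₂_of_rows hmi.1 h2 hg, hfit⟩ (h.rows_cons hg hmi.1)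
      (fun j hj => by
        have hj' : m.testBit j ∧ j ≠ i := by
          obtain ⟨a1, a2, _ | _⟩ := a
          · rw [testBit_xor_pow h1, Bool.and_eq_true, decide_eq_true_iff] at hj
            exact hj
          · change (m &&& full i).testBit j = true at hj
            rw [Nat.testBit_and, testBit_full, Bool.and_eq_true, decide_eq_true_iff] at hj
            exact ⟨hj.1, hj.2.ne⟩
        refine ⟨(hm j hj'.1).1, ?_⟩
        rw [List.mem_cons, not_or]
        exact ⟨fun e => hj'.2 (h.inj j (hm j hj'.1).1 i hmi.1 e), (hm j hj'.1).2⟩)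
      (by simpa [hwus] using (hw i hmi.1).symm)
      (fun hj => by
        have hj' (j) : q₀.testBit j = true ∨ (traceBit a.2.1 i).testBit j = true →
            y.testBit j = true := by
          rw [← Bool.or_eq_true, ← Nat.testBit_or]
          exact hj j
        exact .cons (hy _ _ hmi.1 fun j hj => hj' j (.inr hj))
          (hbs fun j hj => hj' j (.inl hj))) hq'
    rcases this with h3 | ⟨us', h3⟩
    · exact hz h3
    · exact .inr ⟨us', by simpa using h3⟩

theorem containsInduced_of_hits (h : Realizes G W s f) {S : ℕ}
    (hS : ∀ i < s.n, (S.testBit i = true ↔ G.Adj (f s.n) (f i))) (hv : f s.n ∈ W)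
    (hvf : ∀ i < s.n, f i ≠ f s.n) {w : V} (hw : w ∈ W) (hwf : ∀ i < s.n + 1, f i ≠ w) {y : ℕ}
    (hn : s.n < 16) (hy : IsTrace G f (s.n + 1) w y) {b : Bool} (hb : b = true ↔ G.Adj w (f s.n))
    (hit : hits y (forbidden s.R s.n S (traceBit b s.n)
      (cond b adjacentPlacements nonadjacentPlacements)) = true) :
    ContainsInduced P2UnionP4 G := by
  obtain ⟨q, hq, hqy⟩ := hits_eq_true.1 hit
  refine fold_induction (P := fun z : List ℕ => q ∈ z → _) (by simp) (fun p z hp hz hq => ?_) hq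
  have := h.fits_of_completions (w := w) (y := y) (us := [f s.n]) (L₀ := [[]]) (bs := [b])
    (fun c i hi hc => ?_) (fun i hi => hwf i (by omega)) ⟨hv, by simp, .nil, trivial⟩
    (.cons hS .nil) (fun i hi => ?_) (by simpa using (hwf s.n (by omega)).symm)
    (fun _ => .cons hb .nil) hq hqy
  · rcases this with h1 | ⟨us', h1, h2, h3⟩
    · exact hz h1
    · refine containsInduced_P2UnionP4 (W := W) (us := w :: us') hp ?_
      simpa [placementGraph] using ⟨hw, h2, by simpa using h3, by simpa using h1⟩
  · cases c with
    | true =>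
      have := (hy i).1 (hc i (by simp [testBit_traceBit_true]))
      simp only [true_iff]
      rcases this with h1 | h1
      · exact h1.2
      · omega
    | false =>
      have := (hy (16 + i)).1 (hc _ (by simp [testBit_traceBit_false]))
      rw [Nat.add_sub_cancel_left] at this
      rcases this with h1 | h1
      · omega
      · simpa using h1.2.2
  · rw [testBit_full, decide_eq_true_iff] at hi
    exact ⟨hi, by simpa using hvf i hi⟩

theorem mem_keep {P : List ℕ} {x y : ℕ} {z : List ℕ} :
    y ∈ keep P x z ↔ (y = x ∧ hits x P = false) ∨ y ∈ z := by
  rw [keep, force_eq]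
  cases hits x P <;> simp

theorem mem_refine {S wi wo : ℕ} {P Q l : List ℕ} {x : ℕ} (hx : x ∈ l) :
    (hits (x ||| wo) P = false → x ||| wo ∈ refine S wi wo P Q l) ∧
      (x &&& S = 0 → hits (x ||| wi) Q = false → x ||| wi ∈ refine S wi wo P Q l) := by
  have hstep (y a : ℕ) (z : List ℕ) : y ∈ keep P (a ||| wo) (Bool.rec z (keep Q (a ||| wi) z)
      (Nat.beq (a &&& S) 0)) ↔ (y = a ||| wo ∧ hits (a ||| wo) P = false) ∨
        (a &&& S = 0 ∧ y = a ||| wi ∧ hits (a ||| wi) Q = false) ∨ y ∈ z := by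
    have h0 : a &&& S = 0 ↔ Nat.beq (a &&& S) 0 = true := by rw [Nat.beq_eq]
    rw [mem_keep, h0]
    refine or_congr_right ?_
    cases Nat.beq (a &&& S) 0
    · simp
    · simp [mem_keep]
  rw [refine, fold_eq]
  induction l with
  | nil => simp at hx
  | cons a l ih =>
    rw [List.foldr_cons]
    constructor
    · intro h1
      refine (hstep _ _ _).2 ?_
      rcases List.mem_cons.1 hx with rfl | hx
      · exact .inl ⟨rfl, h1⟩
      · exact .inr (.inr ((ih hx).1 h1))
    · intro h1 h2
      refine (hstep _ _ _).2 ?_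
      rcases List.mem_cons.1 hx with rfl | hx
      · exact .inr (.inl ⟨h1, rfl, h2⟩)
      · exact .inr (.inr ((ih hx).2 h1 h2))

theorem add_eq (s : State) (x : ℕ) : add s x = ⟨extend s.R s.n (Nat.land x 65535), s.n + 1,
    refine (Nat.land x 65535) (traceBit true s.n) (traceBit false s.n)
      (forbidden s.R s.n (Nat.land x 65535) (traceBit false s.n) nonadjacentPlacements)
      (forbidden s.R s.n (Nat.land x 65535) (traceBit true s.n) adjacentPlacements) s.cands⟩ := by
  simp only [add, force_eq]

theorem add (h : Realizes G W s f) (hP : ¬ ContainsInduced P2UnionP4 G)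
    (hC : ∀ a b c, G.Adj a b → G.Adj b c → ¬ G.Adj a c) (hn : s.n < 16) {x : ℕ}
    (hx : ∀ i < 16, (x.testBit i = true ↔ i < s.n ∧ G.Adj (f s.n) (f i))) (hv : f s.n ∈ W)
    (hvf : ∀ i < s.n, f i ≠ f s.n) : Realizes G W (CriticalSearch.add s x) f := by
  rw [add_eq]
  set S := Nat.land x 65535 with hSdef
  have hS (i) : S.testBit i = true ↔ i < s.n ∧ G.Adj (f s.n) (f i) := by
    rw [hSdef, testBit_land_low, Bool.and_eq_true, decide_eq_true_iff]
    constructor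
    · rintro ⟨h1, h2⟩
      exact (hx i h2).1 h1
    · intro h1
      have : i < 16 := by omega
      exact ⟨(hx i this).2 h1, this⟩
  have hSlt : S < 65536 := Nat.lt_pow_two_of_testBit (n := 16) _ fun i hi => by
    rw [← Bool.not_eq_true, hS]
    omega
  refine ⟨hn, fun i hi => ?_, fun i hi j hj hij => ?_, fun p => ?_, fun w hw hwf => ?_⟩
  · rcases Nat.lt_succ_iff_lt_or_eq.1 hi with hi | rfl
    exacts [h.mem i hi, hv]
  · rcases Nat.lt_succ_iff_lt_or_eq.1 hi with hi | rfl <;>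
      rcases Nat.lt_succ_iff_lt_or_eq.1 hj with hj | rfl
    exacts [h.inj i hi j hj hij, (hvf i hi hij).elim, (hvf j hj hij.symm).elim, rfl]
  · change (extend s.R s.n S).testBit p = true ↔
      p / 16 < s.n + 1 ∧ p % 16 < s.n + 1 ∧ G.Adj (f (p / 16)) (f (p % 16))
    rw [testBit_extend hSlt hn, h.adj, hS, hS]
    by_cases h1 : p / 16 < s.n
    · have h2 : ¬ 16 * s.n ≤ p := by omega
      by_cases h3 : p % 16 = s.n
      · simp [h1, h2, h3, G.adj_comm, show p / 16 < s.n + 1 by omega]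
      · have : p % 16 < s.n + 1 ↔ p % 16 < s.n := by omega
        simp [h1, h2, h3, this, show p / 16 < s.n + 1 by omega]
    · by_cases h2 : p / 16 = s.n
      · have h3 : p - 16 * s.n = p % 16 := by omega
        rw [h2, h3]
        by_cases h4 : p % 16 = s.n
        · simp [h4]
        · have : p % 16 < s.n + 1 ↔ p % 16 < s.n := by omega
          simp [h4, this, show 16 * s.n ≤ p by omega]
      · simp [h1, show ¬ p / 16 < s.n + 1 by omega, show ¬ p - 16 * s.n < s.n by omega]
  · change ∃ y ∈ refine _ _ _ _ _ _, IsTrace G f (s.n + 1) w y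
    obtain ⟨y, hy, hyt⟩ := h.cands w hw fun i hi => hwf i (Nat.lt_succ_of_lt hi)
    by_cases hwv : G.Adj w (f s.n)
    · have ht : IsTrace G f (s.n + 1) w (y ||| traceBit true s.n) := fun p => by
        rw [Nat.testBit_or, Bool.or_eq_true, hyt p, testBit_traceBit_true, decide_eq_true_iff]
        by_cases hp : s.n = p
        · subst hp; simp [hwv]
        · by_cases hp' : p = 16 + s.n
          · subst hp'; simp [hwv]
          · have h1 : p < s.n + 1 ↔ p < s.n := by omega
            have h2 : p < 16 + (s.n + 1) ↔ p < 16 + s.n := by omega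
            simp [hp, h1, h2]
      refine ⟨_, (mem_refine hy).2 ?_ ?_, ht⟩
      · refine Nat.eq_of_testBit_eq fun i => ?_
        rw [Nat.testBit_and, Nat.zero_testBit, ← Bool.not_eq_true, Bool.and_eq_true, hyt, hS]
        rintro ⟨h1, h2, h3⟩
        rcases h1 with h1 | h1
        · exact hC _ _ _ hwv h3 h1.2
        · omega
      · rw [← Bool.not_eq_true]
        exact fun hit => hP (h.containsInduced_of_hits (b := true)
          (fun i hi => by rw [hS]; simp [hi]) hv hvf hw hwf hn ht (by simp [hwv]) hit)
    · have ht : IsTrace G f (s.n + 1) w (y ||| traceBit false s.n) := fun p => by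
        rw [Nat.testBit_or, Bool.or_eq_true, hyt p, testBit_traceBit_false, decide_eq_true_iff]
        by_cases hp : p = s.n
        · subst hp; simp [hwv]; omega
        · by_cases hp' : 16 + s.n = p
          · subst hp'; simp [hwv]
          · have h1 : p < s.n + 1 ↔ p < s.n := by omega
            have h2 : p < 16 + (s.n + 1) ↔ p < 16 + s.n := by omega
            simp [hp', h1, h2]
      refine ⟨_, (mem_refine hy).1 ?_, ht⟩
      rw [← Bool.not_eq_true]
      exact fun hit => hP (h.containsInduced_of_hits (b := false)
        (fun i hi => by rw [hS]; simp [hi]) hv hvf hw hwf hn ht (by simp [hwv]) hit)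

end Realizes

/-- Some vertex of `W` outside the labelled graph has a trace that contains a member of `rule`. -/
def Valid (G : SimpleGraph V) (W : Set V) (s : State) (f : ℕ → V) (rule : List ℕ) : Prop :=
  ∃ w ∈ W, (∀ i < s.n, f i ≠ w) ∧ ∀ y, IsTrace G f s.n w y → hits y rule = true

namespace IsTrace

variable {f : ℕ → V} {n : ℕ} {w : V} {y : ℕ}

theorem adj (h : IsTrace G f n w y) {a i : ℕ} (ha : a < n) (hwa : G.Adj w (f a))
    (hi : (traceBit true a).testBit i = true) : y.testBit i = true := by
  rw [testBit_traceBit_true, decide_eq_true_iff] at hi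
  subst hi
  exact (h _).2 (.inl ⟨ha, hwa⟩)

theorem separating (h : IsTrace G f n w y) {a b i : ℕ} (ha : a < n) (hb : b < n)
    (hwa : G.Adj w (f a)) (hwb : ¬ G.Adj w (f b)) (hi : (separating a b).testBit i = true) :
    y.testBit i = true := by
  change (traceBit true a ||| traceBit false b).testBit i = true at hi
  rw [Nat.testBit_or, Bool.or_eq_true] at hi
  rcases hi with hi | hi
  · exact h.adj ha hwa hi
  · rw [testBit_traceBit_false, decide_eq_true_iff] at hi
    subst hi
    exact (h _).2 (.inr ⟨by omega, by omega, by rwa [Nat.add_sub_cancel_left]⟩)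

end IsTrace

namespace Realizes

variable {s : State} {f : ℕ → V} {k : ℕ}

theorem valid_of_mem_vertexRules (h : Realizes G W s f) (hW : Critical G k W) {r : List ℕ}
    (hr : r ∈ vertexRules s) : Valid G W s f r := by
  refine foldBits_induction (P := fun z : List (List ℕ) => r ∈ z → _) (by simp)
    (fun x z hx hz hr => ?_) hr
  refine foldBits_induction (P := fun z : List (List ℕ) => r ∈ z → _) hz
    (fun y z hy hz hr => ?_) hr
  rw [testBit_full, decide_eq_true_iff] at hx
  change (full s.n ^^^ (row s.R x ||| 2 ^ x)).testBit y = true at hy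
  rw [Nat.testBit_xor, Nat.testBit_or, Nat.testBit_two_pow, testBit_full] at hy
  have hxy : x ≠ y ∧ y < s.n := by
    have h1 : (row s.R x).testBit y = true → y < s.n := fun e => (h.testBit_row.1 e).2.1
    by_cases h2 : y < s.n
    · refine ⟨?_, h2⟩
      rintro rfl
      simp [h2] at hy
    · have h3 : x ≠ y := by omega
      simp [h2, h3] at hy
      exact (h2 (h1 hy)).elim
  revert hr
  cases hsub : subset (row s.R x) (row s.R y) with
  | false => exact hz
  | true =>
    intro hr
    rcases List.mem_cons.1 hr with rfl | hr
    · obtain ⟨w, hw, hwx, hwy⟩ := hW.exists_adj_not_adj (h.mem x hx) (h.mem y hxy.2)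
        fun e => hxy.1 (h.inj x hx y hxy.2 e)
      refine ⟨w, hw, fun i hi => ?_, fun t ht => hits_eq_true.2
        ⟨_, List.mem_singleton_self _, fun i => ht.separating hx hxy.2 hwx hwy⟩⟩
      rintro rfl
      exact hwy (h.testBit_row.1
        (subset_eq_true hsub (h.testBit_row.2 ⟨hx, hi, hwx.symm⟩))).2.2.symm
    · exact hz hr

theorem adj_of_mem_edges (h : Realizes G W s f) {e : ℕ × ℕ} (he : e ∈ edges s) :
    e.1 < s.n ∧ e.2 < s.n ∧ G.Adj (f e.1) (f e.2) := by
  refine foldBits_induction (P := fun z : List (ℕ × ℕ) => e ∈ z → _) (by simp)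
    (fun x z hx hz he => ?_) he
  refine foldBits_induction (P := fun z : List (ℕ × ℕ) => e ∈ z → _) hz
    (fun y z hy hz he => ?_) he
  rcases List.mem_cons.1 he with rfl | he
  · exact h.testBit_row.1 hy
  · exact hz he

theorem nested_eq_true {R : ℕ} {e d : ℕ × ℕ} (h : nested R e d = true) :
    (d.1 ≠ e.1 ∧ d.1 ≠ e.2 ∧ d.2 ≠ e.1 ∧ d.2 ≠ e.2) ∧
      (∀ i, i ≠ e.2 → (row R e.1).testBit i = true → (row R d.1).testBit i = true) ∧
      ∀ i, i ≠ e.1 → (row R e.2).testBit i = true → (row R d.2).testBit i = true := by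
  revert h
  rw [nested]
  cases h1 : Nat.beq (Nat.land (Nat.lor (Nat.pow 2 e.1) (Nat.pow 2 e.2))
    (Nat.lor (Nat.pow 2 d.1) (Nat.pow 2 d.2))) 0 with
  | false => simp
  | true =>
    cases h2 : subset (row R e.1) (Nat.lor (Nat.pow 2 e.2) (row R d.1)) with
    | false => simp
    | true =>
      intro h3
      refine ⟨?_, fun i hi hi' => ?_, fun i hi hi' => ?_⟩
      · have h0 : (2 ^ e.1 ||| 2 ^ e.2) &&& (2 ^ d.1 ||| 2 ^ d.2) = 0 := Nat.eq_of_beq_eq_true h1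
        have ht (i) : ((2 ^ e.1 ||| 2 ^ e.2) &&& (2 ^ d.1 ||| 2 ^ d.2)).testBit i = false := by
          rw [h0, Nat.zero_testBit]
        simp only [Nat.testBit_and, Nat.testBit_or, Nat.testBit_two_pow] at ht
        have ht1 := ht d.1
        have ht2 := ht d.2
        simp only [decide_true, Bool.true_or, Bool.or_true, Bool.and_true, Bool.or_eq_false_iff,
          decide_eq_false_iff_not] at ht1 ht2
        exact ⟨Ne.symm ht1.1, Ne.symm ht1.2, Ne.symm ht2.1, Ne.symm ht2.2⟩
      · have := subset_eq_true h2 hi'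
        change (2 ^ e.2 ||| row R d.1).testBit i = true at this
        rwa [Nat.testBit_or, Nat.testBit_two_pow_of_ne hi.symm, Bool.false_or] at this
      · have := subset_eq_true h3 hi'
        change (2 ^ e.1 ||| row R d.2).testBit i = true at this
        rwa [Nat.testBit_or, Nat.testBit_two_pow_of_ne hi.symm, Bool.false_or] at this

theorem valid_of_mem_edgeRules (h : Realizes G W s f) (hW : Critical G k W) {r : List ℕ}
    (hr : r ∈ edgeRules s) : Valid G W s f r := by
  refine fold_induction (P := fun z : List (List ℕ) => r ∈ z → _) (by simp)
    (fun e z he hz hr => ?_) hr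
  refine fold_induction (P := fun z : List (List ℕ) => r ∈ z → _) hz
    (fun d z hd hz hr => ?_) hr
  obtain ⟨he1, he2, he⟩ := h.adj_of_mem_edges he
  obtain ⟨hd1, hd2, hd⟩ := h.adj_of_mem_edges hd
  revert hr
  cases hn : nested s.R e d with
  | false => exact hz
  | true =>
    intro hr
    rcases List.mem_cons.1 hr with rfl | hr
    · obtain ⟨⟨n1, n2, n3, n4⟩, n5, n6⟩ := nested_eq_true hn
      obtain ⟨w, hw, hwed⟩ := hW.exists_adj_not_adj_of_edges (h.mem _ he1) (h.mem _ he2)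
        (h.mem _ hd1) (h.mem _ hd2) (fun q => n1 (h.inj _ hd1 _ he1 q))
        (fun q => n2 (h.inj _ hd1 _ he2 q)) (fun q => n3 (h.inj _ hd2 _ he1 q))
        (fun q => n4 (h.inj _ hd2 _ he2 q)) he hd
      refine ⟨w, hw, fun i hi => ?_, fun t ht => hits_eq_true.2 ?_⟩
      · rintro rfl
        rcases hwed with ⟨w1, w2, w3⟩ | ⟨w1, w2, w3⟩
        · exact w3 (h.testBit_row.1 (n5 i (fun q => w2 (congrArg f q))
            (h.testBit_row.2 ⟨he1, hi, w1.symm⟩))).2.2.symm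
        · exact w3 (h.testBit_row.1 (n6 i (fun q => w2 (congrArg f q))
            (h.testBit_row.2 ⟨he2, hi, w1.symm⟩))).2.2.symm
      · rcases hwed with ⟨w1, w2, w3⟩ | ⟨w1, w2, w3⟩
        · exact ⟨_, by simp, fun i => ht.separating he1 hd1 w1 w3⟩
        · exact ⟨separating e.2 d.2, by simp, fun i => ht.separating he2 hd2 w1 w3⟩
    · exact hz hr

theorem row_lt (R i : ℕ) : row R i < 65536 :=
  Nat.lt_pow_two_of_testBit (n := 16) _ fun j hj => by
    rw [CriticalSearch.testBit_row]
    simp [hj.not_gt]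

theorem valid_of_mem_degreeRules (h : Realizes G W s f) (hW : Critical G k W) {r : List ℕ}
    (hr : r ∈ degreeRules k s) : Valid G W s f r := by
  refine foldBits_induction (P := fun z : List (List ℕ) => r ∈ z → _) (by simp)
    (fun x z hx hz hr => ?_) hr
  rw [testBit_full, decide_eq_true_iff] at hx
  revert hr
  cases hc : Nat.blt (count (row s.R x)) k with
  | false => exact hz
  | true =>
    intro hr
    rcases List.mem_cons.1 hr with rfl | hr
    · obtain ⟨l, hl, hl'⟩ := exists_elements_of_count_lt (row_lt _ _) hc
      obtain ⟨w, hw, hwx, hwl⟩ :=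
        hW.exists_adj_notMem (h.mem x hx) (l := l.map f) (by simpa using hl)
      refine ⟨w, hw, fun i hi => ?_, fun t ht => hits_eq_true.2
        ⟨_, List.mem_singleton_self _, fun i => ht.adj hx hwx⟩⟩
      rintro rfl
      exact hwl (List.mem_map_of_mem (hl' i (h.testBit_row.2 ⟨hx, hi, hwx.symm⟩)))
    · exact hz hr

theorem exists_coloring_of_colours (h : Realizes G W s f) {t i : ℕ} {cs : List ℕ} (hi : i + t ≤ s.n)
    {c : ℕ → ℕ} (hc : ∀ p < i, c p < k ∧ (cs.getD (c p) 0).testBit p = true)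
    (hc' : ∀ p < i, ∀ q < i, G.Adj (f p) (f q) → c p ≠ c q) (hcs : cs.length = k)
    (hcol : colours k s.R t i cs = true) :
    ∃ c : ℕ → ℕ, (∀ p < i + t, c p < k) ∧
      ∀ p < i + t, ∀ q < i + t, G.Adj (f p) (f q) → c p ≠ c q := by
  induction t generalizing i cs c with
  | zero => exact ⟨c, fun p hp => (hc p hp).1, hc'⟩
  | succ t ih =>
    rw [colours, List.any_eq_true] at hcol
    obtain ⟨j, hj, hcol⟩ := hcol
    rw [Bool.and_eq_true] at hcol
    obtain ⟨h1, h2⟩ := hcol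
    rw [List.mem_range] at hj
    have h0 : cs.getD j 0 &&& row s.R i = 0 := Nat.eq_of_beq_eq_true h1
    have hdisj : ∀ p < i, c p = j → ¬ G.Adj (f i) (f p) := fun p hp hpj hadj => by
      have e1 : (cs.getD j 0 &&& row s.R i).testBit p = true := by
        rw [Nat.testBit_and, ← hpj, (hc p hp).2, h.testBit_row.2 ⟨by omega, by omega, hadj⟩]
        rfl
      rw [h0] at e1
      simp at e1
    have := ih (i := i + 1) (c := Function.update c i j) (by omega) (fun p hp => ?_) ?_
      (by simpa using hcs) h2
    · obtain ⟨c', h3, h4⟩ := this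
      rw [show i + 1 + t = i + (t + 1) by omega] at h3 h4
      exact ⟨c', h3, h4⟩
    · have hget (l : ℕ) (hl : l < k) : (cs.modify j (Nat.lor (Nat.pow 2 i))).getD l 0 =
          if j = l then 2 ^ i ||| cs.getD l 0 else cs.getD l 0 := by
        rw [List.getD_eq_getElem?_getD, List.getElem?_modify, List.getD_eq_getElem?_getD,
          List.getElem?_eq_getElem (by omega)]
        split_ifs <;> rfl
      by_cases hpi : p = i
      · subst hpi
        rw [Function.update_self, hget j hj, if_pos rfl, Nat.testBit_or, Nat.testBit_two_pow_self]
        simpa using hj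
      · have hp' : p < i := by omega
        rw [Function.update_of_ne hpi, hget _ (hc p hp').1]
        refine ⟨(hc p hp').1, ?_⟩
        split_ifs
        · rw [Nat.testBit_or, (hc p hp').2, Bool.or_true]
        · exact (hc p hp').2
    · intro p hp q hq hpq
      by_cases hpi : p = i
      · subst hpi
        have hqp : q ≠ p := by rintro rfl; exact hpq.ne rfl
        rw [Function.update_self, Function.update_of_ne hqp]
        exact fun e => hdisj q (by omega) e.symm hpq
      · by_cases hqi : q = i
        · subst hqi
          rw [Function.update_self, Function.update_of_ne hpi]
          exact fun e => hdisj p (by omega) e hpq.symm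
        · rw [Function.update_of_ne hpi, Function.update_of_ne hqi]
          exact hc' p (by omega) q (by omega) hpq

theorem valid_of_mem_colourRules (h : Realizes G W s f) (hW : Critical G k W) {r : List ℕ}
    (hr : r ∈ colourRules k s) : Valid G W s f r := by
  revert hr
  rw [colourRules]
  cases hc : colours k s.R s.n 0 (List.replicate k 0) with
  | false => simp
  | true =>
    intro hr
    obtain rfl := List.mem_singleton.1 hr
    obtain ⟨c, h1, h2⟩ :=
      h.exists_coloring_of_colours (c := fun _ => 0) (by omega) (by simp) (by simp)
      (by simp) hc
    rw [Nat.zero_add] at h1 h2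
    obtain ⟨w, hw, hwf⟩ : ∃ w ∈ W, ∀ i < s.n, f i ≠ w := by
      by_contra! hcon
      choose! g hg hg' using hcon
      exact hW.1 ⟨fun v => c (g v), fun v hv => h1 _ (hg v hv), fun u hu v hv huv =>
        h2 _ (hg u hu) _ (hg v hv) (by rwa [hg' u hu, hg' v hv])⟩
    exact ⟨w, hw, hwf, fun t _ => hits_eq_true.2 ⟨0, by simp, by simp⟩⟩

/-- Some vertex of `W` outside the labelled graph has a trace in `l`. -/
def Live (G : SimpleGraph V) (W : Set V) (s : State) (f : ℕ → V) (l : List ℕ) : Prop :=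
  ∃ x ∈ l, ∃ w ∈ W, (∀ i < s.n, f i ≠ w) ∧ IsTrace G f s.n w x

theorem live_branches (h : Realizes G W s f) {r : List ℕ} (hr : Valid G W s f r) :
    Live G W s f (branches s r) := by
  obtain ⟨w, hw, hwf, hr⟩ := hr
  obtain ⟨x, hx, hxt⟩ := h.cands w hw hwf
  refine ⟨x, ?_, w, hw, hwf, hxt⟩
  rw [branches, fold_eq]
  generalize s.cands = l at hx
  induction l with
  | nil => simp at hx
  | cons a l ih =>
    rw [List.foldr_cons]
    rcases List.mem_cons.1 hx with rfl | hx
    · rw [hr _ hxt]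
      exact List.mem_cons_self
    · cases hits a r
      · exact ih hx
      · exact List.mem_cons_of_mem _ (ih hx)

theorem shortest_induction (P : List ℕ → Prop) {l : List (List ℕ)} {b : List ℕ} (hb : P b)
    (hl : ∀ c ∈ l, P c) : P (shortest l b) := by
  induction l generalizing b with
  | nil => exact hb
  | cons c l ih =>
    have hl' : ∀ c ∈ l, P c := fun c hc => hl c (List.mem_cons_of_mem _ hc)
    change P (Bool.rec (shortest l c) (shortest l b) (Nat.ble (len b) (len c)))
    cases Nat.ble (len b) (len c)
    · exact ih (hl c List.mem_cons_self) hl'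
    · exact ih hb hl'

theorem live_of_choose (h : Realizes G W s f) {l : List (List (List ℕ))}
    (hl : ∀ Rs ∈ l, ∀ r ∈ Rs, Valid G W s f r) {c : List ℕ} (hc : choose s l = some c) :
    Live G W s f c := by
  refine fold_induction (P := fun z : Option (List ℕ) => z = some c → _) (by simp)
    (fun Rs z hRs hz => ?_) hc
  cases Rs with
  | nil => exact hz
  | cons r rs =>
    intro hc
    obtain rfl := Option.some.inj hc
    refine shortest_induction _ (h.live_branches (hl _ hRs r List.mem_cons_self)) ?_
    refine fold_induction (P := fun z : List (List ℕ) => ∀ c ∈ z, Live G W s f c) (by simp)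
      fun r' z hr' hz c hc => ?_
    rcases List.mem_cons.1 hc with rfl | hc
    · exact h.live_branches (hl _ hRs r' (List.mem_cons_of_mem _ hr'))
    · exact hz c hc

theorem copy_of_dead (hP : ¬ ContainsInduced P2UnionP4 G)
    (hC : ∀ a b c, G.Adj a b → G.Adj b c → ¬ G.Adj a c) (hW : Critical G k W)
    {cfgs : List Config} (hcfgs : ∀ c ∈ cfgs, c ≠ []) {t : ℕ} (h : Realizes G W s f)
    (ht : t + s.n ≤ 16) (hd : dead k cfgs t s = true) :
    ∃ c ∈ cfgs, Copy G W c.length (adjOf (c.map (·.1))) := by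
  induction t generalizing s f with
  | zero => cases hd
  | succ t ih =>
    cases hr : rejected cfgs s with
    | true => exact h.copy_of_rejected hcfgs hr
    | false =>
      change Bool.rec (motive := fun _ => Bool) (Option.rec false (fun c => fold (fun x z =>
        Bool.rec false z (dead k cfgs t (CriticalSearch.add s x))) c true)
          (choose s [vertexRules s, edgeRules s, degreeRules k s, colourRules k s])) true
            (rejected cfgs s) = true at hd
      rw [hr] at hd
      cases hc : choose s [vertexRules s, edgeRules s, degreeRules k s, colourRules k s] with
      | none => rw [hc] at hd; cases hd
      | some c =>
        rw [hc] at hd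
        obtain ⟨x, hx, w, hw, hwf, hxt⟩ := h.live_of_choose (fun Rs hRs r hr => by
          simp only [List.mem_cons, List.not_mem_nil, or_false] at hRs
          rcases hRs with rfl | rfl | rfl | rfl
          exacts [h.valid_of_mem_vertexRules hW hr, h.valid_of_mem_edgeRules hW hr,
            h.valid_of_mem_degreeRules hW hr, h.valid_of_mem_colourRules hW hr]) hc
        have hdx : dead k cfgs t (CriticalSearch.add s x) = true := by
          change fold (fun x z => Bool.rec false z (dead k cfgs t (CriticalSearch.add s x))) c
            true =
            true at hd
          rw [fold_eq] at hd
          clear hc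
          induction c with
          | nil => simp at hx
          | cons a c ihc =>
            rw [List.foldr_cons] at hd
            cases ha : dead k cfgs t (CriticalSearch.add s a) with
            | false => rw [ha] at hd; cases hd
            | true =>
              rw [ha] at hd
              rcases List.mem_cons.1 hx with rfl | hx
              · exact ha
              · exact ihc hx hd
        have hf : ∀ i < s.n, Function.update f s.n w i = f i := fun i hi =>
          Function.update_of_ne hi.ne _ _
        refine ih (s := CriticalSearch.add s x) (f := Function.update f s.n w)
          ((h.congr hf).add hP hC (by omega) (fun i hi => ?_) ?_ fun i hi => ?_) ?_ hdx
        · rw [hxt i, Function.update_self]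
          constructor
          · rintro (⟨h1, h2⟩ | h1)
            · exact ⟨h1, by rwa [hf i h1]⟩
            · omega
          · rintro ⟨h1, h2⟩
            exact .inl ⟨h1, by rwa [hf i h1] at h2⟩
        · simpa using hw
        · rw [hf i hi, Function.update_self]
          exact hwf i hi
        · rw [add_eq]
          change t + (s.n + 1) ≤ 16
          omega

end Realizes

/-- The adjacency relation in which label `i` has the lower neighbours `L[i]`. -/
def maskAdj (L : List ℕ) (i j : ℕ) : Bool :=
  bif j < i then (L.getD i 0).testBit j else bif i < j then (L.getD j 0).testBit i else false

theorem add_n (s : State) (x : ℕ) : (add s x).n = s.n + 1 := by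
  rw [Realizes.add_eq]

theorem realizes_build [Nonempty V] (hP : ¬ ContainsInduced P2UnionP4 G)
    (hC : ∀ a b c, G.Adj a b → G.Adj b c → ¬ G.Adj a c) {L : List ℕ} (hL : L.length ≤ 16)
    (hlt : ∀ i < L.length, L.getD i 0 < 2 ^ i) (h : Copy G W L.length (maskAdj L)) :
    ∃ f, Realizes G W (build L) f ∧ (build L).n = L.length := by
  obtain ⟨g, h1, h2, h3⟩ := h
  refine ⟨g, ?_⟩
  have key : ∀ m ≤ L.length, Realizes G W (build (L.take m)) g ∧ (build (L.take m)).n = m := by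
    intro m hm
    induction m with
    | zero =>
      refine ⟨⟨by simp [build], by simp [build], by simp [build], by simp [build],
        fun w _ _ => ⟨0, by simp [build], fun p => ?_⟩⟩, by simp [build]⟩
      simp [build]
      omega
    | succ m ih =>
      obtain ⟨i1, i2⟩ := ih (by omega)
      have hb : build (L.take (m + 1)) = add (build (L.take m)) (L.getD m 0) := by
        rw [build, List.take_add_one, List.getElem?_eq_getElem (by omega), Option.toList_some,
          List.foldl_append, List.getD_eq_getElem _ _ (by omega)]
        rfl
      rw [hb, add_n, i2]
      refine ⟨i1.add hP hC (by omega) (fun i hi => ?_) ?_ fun i hi => ?_, rfl⟩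
      · rw [i2]
        by_cases him : i < m
        · rw [← h3 m (by omega) i (by omega)]
          simp [maskAdj, him]
        · have : L.getD m 0 < 2 ^ i :=
            (hlt m (by omega)).trans_le (Nat.pow_le_pow_right (by omega) (by omega))
          rw [Nat.testBit_lt_two_pow this]
          simp [him]
      · rw [i2]; exact h1 m (by omega)
      · rw [i2] at hi ⊢
        exact fun e => hi.ne (h2 i (by omega) m (by omega) e)
  simpa using key L.length le_rfl

theorem copy_of_dead_build {k : ℕ} [Nonempty V] (hP : ¬ ContainsInduced P2UnionP4 G)
    (hC : ∀ a b c, G.Adj a b → G.Adj b c → ¬ G.Adj a c) (hW : Critical G k W) {L : List ℕ}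
    (hlt : ∀ i < L.length, L.getD i 0 < 2 ^ i) (h : Copy G W L.length (maskAdj L))
    {cfgs : List Config} (hcfgs : ∀ c ∈ cfgs, c ≠ []) {t : ℕ} (ht : t + L.length ≤ 16)
    (hd : dead k cfgs t (build L) = true) :
    ∃ c ∈ cfgs, Copy G W c.length (adjOf (c.map (·.1))) := by
  obtain ⟨f, hf, hn⟩ := realizes_build hP hC (by omega) hlt h
  exact hf.copy_of_dead hP hC hW hcfgs (hn.symm ▸ ht) hd
def fiveCycle : Config :=
  [([], 2), ([true], 2), ([true, false], 2), ([true, false, false], 2),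
   ([true, false, false, true], 2)]

def sevenCycle : Config :=
  [([], 2), ([true], 2), ([true, false], 2), ([true, false, false], 2),
   ([true, false, false, false], 2), ([true, false, false, false, false], 2),
   ([true, false, false, false, false, true], 2)]

def nineVertexConfig : Config :=
  [([], 3), ([true], 4), ([false, true], 3), ([true, false, false], 3),
   ([false, false, false, true], 3), ([false, true, false, true, false], 3),
   ([true, true, false, false, false, false], 3),
   ([false, false, true, true, false, true, false], 3),
   ([false, true, false, false, false, true, true, false], 3)]

def tenVertexConfig : Config :=
  [([], 4), ([true], 4), ([false, false], 4), ([true, false, true], 3),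
   ([false, false, true, false], 3), ([true, true, false, false, false], 4),
   ([true, false, false, true, true, false], 3),
   ([false, false, false, false, true, true, false], 3),
   ([false, false, false, true, false, true, false, true], 3),
   ([false, true, false, true, false, false, false, false, true], 3)]

def grotzschConfig : Config :=
  [([], 5), ([true], 3), ([true, false], 4), ([true, false, false], 4),
   ([true, false, true, false], 4), ([true, false, false, false, false], 4),
   ([true, false, true, false, false, true], 3),
   ([false, false, true, false, false, false, true], 3),
   ([true, false, true, false, false, true, false, false], 4),
   ([true, false, false, false, false, true, false, false, true], 3),
   ([false, false, false, false, true, false, false, true, false, true], 3)]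

theorem dead_sevenCycle : dead 3 [] 8 (build [0, 1, 2, 4, 8, 16, 33, 0]) = true := by
  decide +kernel

theorem dead_empty : dead 2 [fiveCycle, sevenCycle] 16 (build []) = true := by
  decide +kernel

theorem dead_fiveCycle :
    dead 3 [nineVertexConfig] 10 (build [0, 1, 2, 4, 9, 0]) = true := by
  decide +kernel

theorem dead_nineVertex :
    dead 3 [tenVertexConfig] 7 (build [0, 1, 2, 4, 9, 0, 50, 37, 42]) = true := by
  decide +kernel

theorem dead_tenVertex :
    dead 3 [grotzschConfig] 6 (build [0, 1, 2, 4, 9, 0, 50, 37, 42, 52]) = true := by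
  decide +kernel

/-! ### The theorem -/

theorem Copy.add_isolated {W' : Set V} {k : ℕ} {A : ℕ → ℕ → Bool} (h : Copy G W' k A) (hW : W' ⊆ W)
    {u : V} (hu : u ∈ W) (hu' : ∀ v ∈ W', v ≠ u ∧ ¬ G.Adj v u)
    (hA : ∀ i < k + 1, A i k = false ∧ A k i = false) : Copy G W (k + 1) A := by
  obtain ⟨g, h1, h2, h3⟩ := h
  have hg : ∀ i < k, Function.update g k u i = g i := fun i hi => Function.update_of_ne hi.ne _ _
  refine ⟨Function.update g k u, fun i hi => ?_, fun i hi j hj hij => ?_, fun i hi j hj => ?_⟩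
  · rcases Nat.lt_succ_iff_lt_or_eq.1 hi with hi | rfl
    · rw [hg i hi]; exact hW (h1 i hi)
    · rwa [Function.update_self]
  · rcases Nat.lt_succ_iff_lt_or_eq.1 hi with hi | rfl <;>
      rcases Nat.lt_succ_iff_lt_or_eq.1 hj with hj | rfl
    · rw [hg i hi, hg j hj] at hij
      exact h2 i hi j hj hij
    · rw [hg i hi, Function.update_self] at hij
      exact ((hu' _ (h1 i hi)).1 hij).elim
    · rw [hg j hj, Function.update_self] at hij
      exact ((hu' _ (h1 j hj)).1 hij.symm).elim
    · rfl
  · rcases Nat.lt_succ_iff_lt_or_eq.1 hi with hi' | rfl <;>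
      rcases Nat.lt_succ_iff_lt_or_eq.1 hj with hj' | rfl
    · rw [hg i hi', hg j hj']
      exact h3 i hi' j hj'
    · rw [hg i hi', Function.update_self, (hA i hi).1]
      simpa using (hu' _ (h1 i hi')).2
    · rw [hg j hj', Function.update_self, (hA j hj).2, G.adj_comm]
      simpa using (hu' _ (h1 j hj')).2
    · rw [(hA _ hi).1]
      simp

/-- In a triangle-free graph, the vertices not dominated by `u` need one colour less. -/
theorem not_colorableOn_of_critical {k : ℕ} (hC : ∀ a b c, G.Adj a b → G.Adj b c → ¬ G.Adj a c)
    (hW : Critical G (k + 2) W) {u : V} :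
    ¬ ColorableOn G {v ∈ W | v ≠ u ∧ ¬ G.Adj v u} (k + 1) := by
  classical
  rintro ⟨c, h1, h2⟩
  refine hW.1 ⟨fun v => if v = u then 0 else if G.Adj v u then k + 1 else c v, fun v hv => ?_,
    fun v hv w hw hvw => ?_⟩
  · by_cases h3 : v = u
    · simp [h3]
    · by_cases h4 : G.Adj v u
      · simp [h3, h4]
      · have := h1 v ⟨hv, h3, h4⟩
        simp only [h3, h4, if_false]
        omega
  · by_cases h3 : v = u
    · subst h3
      simp [hvw.ne', hvw.symm]
    · by_cases h4 : w = u
      · subst h4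
        simp [h3, hvw]
      · by_cases h5 : G.Adj v u
        · have h6 : ¬ G.Adj w u := fun h => hC _ _ _ hvw h h5
          have := h1 w ⟨hw, h4, h6⟩
          simp only [h3, h4, h5, h6, if_false, if_true]
          omega
        · by_cases h6 : G.Adj w u
          · have := h1 v ⟨hv, h3, h5⟩
            simp only [h3, h4, h5, h6, if_false, if_true]
            omega
          · simpa [h3, h4, h5, h6] using h2 v ⟨hv, h3, h5⟩ w ⟨hw, h4, h6⟩ hvw

theorem containsInduced_grotzschGraph [Finite V] [Nonempty V] (hP : ¬ ContainsInduced P2UnionP4 G)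
    (hC : ∀ a b c, G.Adj a b → G.Adj b c → ¬ G.Adj a c) (hW : Critical G 3 W) :
    ContainsInduced GrotzschGraph G := by
  by_contra hF
  have h10 : ¬ Copy G W 10 (maskAdj [0, 1, 2, 4, 9, 0, 50, 37, 42, 52]) := fun h => by
    obtain ⟨c, hc, h⟩ := copy_of_dead_build hP hC hW
      (L := [0, 1, 2, 4, 9, 0, 50, 37, 42, 52]) (by decide) h (by decide) (by decide) dead_tenVertex
    obtain rfl := List.mem_singleton.1 hc
    refine hF ((h.relabel [0, 1, 6, 7, 10, 9, 2, 3, 4, 5, 8] (k' := 11)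
      (A' := fun i j => adjOf (grotzschConfig.map (·.1))
        ([0, 1, 6, 7, 10, 9, 2, 3, 4, 5, 8].getD i 0) ([0, 1, 6, 7, 10, 9, 2, 3, 4, 5, 8].getD j 0))
      (by decide) (by decide) fun _ _ _ _ => rfl).containsInduced ?_)
    simp only [GrotzschGraph, SimpleGraph.fromEdgeSet_adj, Set.mem_insert_iff,
      Set.mem_singleton_iff]
    decide +kernel
  have h9 : ¬ Copy G W 9 (maskAdj [0, 1, 2, 4, 9, 0, 50, 37, 42]) := fun h => by
    obtain ⟨c, hc, h⟩ := copy_of_dead_build hP hC hW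
      (L := [0, 1, 2, 4, 9, 0, 50, 37, 42]) (by decide) h (by decide) (by decide) dead_nineVertex
    obtain rfl := List.mem_singleton.1 hc
    exact h10 (h.relabel [4, 1, 0, 9, 5, 2, 6, 8, 7, 3] (by decide) (by decide)
      (by decide +kernel))
  have h6 : ¬ Copy G W 6 (maskAdj [0, 1, 2, 4, 9, 0]) := fun h => by
    obtain ⟨c, hc, h⟩ := copy_of_dead_build hP hC hW
      (L := [0, 1, 2, 4, 9, 0]) (by decide) h (by decide) (by decide) dead_fiveCycle
    obtain rfl := List.mem_singleton.1 hc
    exact h9 (h.relabel [0, 1, 7, 3, 2, 6, 8, 4, 5] (by decide) (by decide) (by decide +kernel))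
  have h8 : ¬ Copy G W 8 (maskAdj [0, 1, 2, 4, 8, 16, 33, 0]) := fun h => by
    obtain ⟨c, hc, -⟩ := copy_of_dead_build hP hC hW
      (L := [0, 1, 2, 4, 8, 16, 33, 0]) (by decide) h (by decide) (by decide) dead_sevenCycle
    cases hc
  obtain ⟨u, hu⟩ : W.Nonempty := by
    rw [Set.nonempty_iff_ne_empty]
    rintro rfl
    exact hW.1 ⟨fun _ => 0, by simp, by simp⟩
  obtain ⟨W', hW', hcrit⟩ :=
    exists_critical_of_not_colorableOn (not_colorableOn_of_critical hC hW (u := u))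
  have hsub : W' ⊆ W := fun v hv => (hW' hv).1
  have hne : ∀ v ∈ W', v ≠ u ∧ ¬ G.Adj v u := fun v hv => (hW' hv).2
  obtain ⟨c, hc, h⟩ := copy_of_dead_build hP hC hcrit (L := []) (by decide)
    ⟨fun _ => u, by simp, by simp, by simp⟩ (by decide) (by decide) dead_empty
  simp only [List.mem_cons, List.not_mem_nil, or_false] at hc
  rcases hc with rfl | rfl
  · exact h6 ((h.add_isolated hsub hu hne (by decide)).relabel (List.range 6)
      (by decide) (by decide) (by decide +kernel))
  · exact h8 ((h.add_isolated hsub hu hne (by decide)).relabel (List.range 8)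
      (by decide) (by decide) (by decide +kernel))

end CriticalSearch

theorem statement_5 {V : Type*} [Fintype V] (G : SimpleGraph V)
    (hconn : G.Connected)
    (hP : ¬ ContainsInduced P2UnionP4 G)
    (hC3 : ¬ ContainsInduced TriangleGraph G)
    (hchi : G.chromaticNumber = 4) :
    ContainsInduced GrotzschGraph G := by
  have hC : ∀ a b c, G.Adj a b → G.Adj b c → ¬ G.Adj a c := fun a b c hab hbc hac => by
    refine hC3 ⟨⟨![a, b, c], fun i j hij => ?_⟩, fun i j => ?_⟩
    · fin_cases i <;> fin_cases j <;>
        simp_all [hab.ne, hbc.ne, hac.ne, hab.ne', hbc.ne', hac.ne']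
    · change G.Adj (![a, b, c] i) (![a, b, c] j) ↔ _
      fin_cases i <;> fin_cases j <;>
        simp [TriangleGraph, hab, hbc, hac, hab.symm, hbc.symm, hac.symm]
  have hcol : ¬ CriticalSearch.ColorableOn G Set.univ 3 := by
    rintro ⟨c, h1, h2⟩
    have : G.Colorable 3 := ⟨SimpleGraph.Coloring.mk (fun v => (⟨c v, h1 v trivial⟩ : Fin 3))
      fun {u v} huv e => h2 u trivial v trivial huv (Fin.ext_iff.1 e)⟩
    have := this.chromaticNumber_le
    rw [hchi] at this
    exact absurd this (by decide)
  have := hconn.nonempty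
  obtain ⟨W, -, hW⟩ := CriticalSearch.exists_critical_of_not_colorableOn hcol
  exact CriticalSearch.containsInduced_grotzschGraph hP hC hW
end
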